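/- arXiv:1309.4968 — 8 statements merged into one kernel-verified Lean document; each statement's English description precedes it below -/
import Mathlib

section
/- For every q ∈ ℂ with q ≠ 0 and every z ∈ ℂ, the q-Jacobi-Stirling numbers satisfy Jc_0^0(z;q) = JS_0^0(z;q) = 1 and, for all integers 0 ≤ k ≤ n, the triangular recurrences Jc_{n+1}^{k+1}(z;q) = Jc_n^k(z;q) + [n]_q·(z + [n]_{q⁻¹})·Jc_n^{k+1}(z;q) and JS_{n+1}^{k+1}(z;q) = JS_n^k(z;q) + [k+1]_q·(z + [k+1]_{q⁻¹})·JS_n^{k+1}(z;q). -/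
/-- `[n]_q := ∑_{i=0}^{n-1} q^i`. -/
noncomputable def qint (q : ℂ) (n : ℕ) : ℂ := ∑ i ∈ Finset.range n, q ^ i

/-- `∏_{i=0}^{k-1}(x - [i]_q(z + [i]_{q⁻¹}))`, the basis defining the
`q`-Jacobi-Stirling numbers. -/
noncomputable def jsPoly (q z : ℂ) (k : ℕ) : Polynomial ℂ :=
  ∏ i ∈ Finset.range k, (Polynomial.X - Polynomial.C (qint q i * (z + qint q⁻¹ i)))

theorem jsPoly_succ_aux (q z : ℂ) (k : ℕ) : jsPoly q z (k + 1) =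
    jsPoly q z k * (Polynomial.X - Polynomial.C (qint q k * (z + qint q⁻¹ k))) := by
  simp only [jsPoly, Finset.prod_range_succ]

theorem jsPoly_monic_aux (q z : ℂ) (k : ℕ) : (jsPoly q z k).Monic :=
  Polynomial.monic_prod_of_monic _ _ (fun _ _ => Polynomial.monic_X_sub_C _)

theorem jsPoly_natDegree_aux (q z : ℂ) (k : ℕ) : (jsPoly q z k).natDegree = k := by
  unfold jsPoly
  rw [Polynomial.natDegree_prod_of_monic _ _ (fun _ _ => Polynomial.monic_X_sub_C _)]
  simp only [Polynomial.natDegree_X_sub_C]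
  simp

theorem jsPoly_indep_aux (q z : ℂ) (c : ℕ → ℂ) (N : ℕ)
    (h : ∑ k ∈ Finset.range N, Polynomial.C (c k) * jsPoly q z k = 0) :
    ∀ k < N, c k = 0 := by
  induction N with
  | zero => intro k hk; omega
  | succ N ih =>
    have hN : c N = 0 := by
      have h2 := congrArg (fun p => Polynomial.coeff p N) h
      simp only [Finset.sum_range_succ, Polynomial.coeff_add,
        Polynomial.finsetSum_coeff, Polynomial.coeff_C_mul, Polynomial.coeff_zero] at h2
      rw [Finset.sum_eq_zero, zero_add] at h2
      · have h3 := (jsPoly_monic_aux q z N).coeff_natDegree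
        rw [jsPoly_natDegree_aux] at h3
        simpa [h3] using h2
      · intro k hk
        rw [Polynomial.coeff_eq_zero_of_natDegree_lt, mul_zero]
        rw [jsPoly_natDegree_aux]
        exact Finset.mem_range.mp hk
    rw [Finset.sum_range_succ, hN] at h
    simp only [map_zero, zero_mul, add_zero] at h
    intro k hk
    rcases Nat.lt_succ_iff_lt_or_eq.mp hk with h1 | h1
    · exact ih h k h1
    · rw [h1, hN]

/-- initial value and triangular recurrence relations for the
`q`-Jacobi-Stirling numbers of the first and second kind. -/
theorem statement7 (q : ℂ) (hq : q ≠ 0) (z : ℂ) (Jc JS : ℕ → ℕ → ℂ)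
    (hJc : ∀ m : ℕ, jsPoly q z m =
      ∑ k ∈ Finset.range (m + 1),
        Polynomial.C ((-1 : ℂ) ^ (m - k) * Jc m k) * Polynomial.X ^ k)
    (hJS : ∀ m : ℕ, (Polynomial.X : Polynomial ℂ) ^ m =
      ∑ k ∈ Finset.range (m + 1), Polynomial.C (JS m k) * jsPoly q z k)
    (hJc0 : ∀ m k : ℕ, m < k → Jc m k = 0)
    (hJS0 : ∀ m k : ℕ, m < k → JS m k = 0) :
    Jc 0 0 = 1 ∧ JS 0 0 = 1 ∧
      ∀ n k : ℕ, k ≤ n →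
        Jc (n + 1) (k + 1) = Jc n k + qint q n * (z + qint q⁻¹ n) * Jc n (k + 1) ∧
        JS (n + 1) (k + 1) = JS n k + qint q (k + 1) * (z + qint q⁻¹ (k + 1)) * JS n (k + 1) := by
  have hco : ∀ m j, (jsPoly q z m).coeff j = (-1 : ℂ) ^ (m - j) * Jc m j := by
    intro m j
    rw [hJc m]
    simp only [Polynomial.finsetSum_coeff, Polynomial.coeff_C_mul, Polynomial.coeff_X_pow]
    by_cases hj : j < m + 1
    · simp [hj]
    · rw [hJc0 m j (by omega)]
      simp [hj]
  refine ⟨?_, ?_, ?_⟩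
  · have := hco 0 0
    simpa [jsPoly] using this.symm
  · have := congrArg (fun p => Polynomial.coeff p 0) (hJS 0)
    simpa [jsPoly] using this.symm
  · intro n k hk
    constructor
    · have h := hco (n + 1) (k + 1)
      rw [jsPoly_succ_aux, mul_sub, Polynomial.coeff_sub, Polynomial.coeff_mul_X,
        Polynomial.coeff_mul_C, hco, hco, Nat.add_sub_add_right] at h
      have hne : ((-1 : ℂ)) ^ (n - k) ≠ 0 := by simp
      apply mul_left_cancel₀ hne
      rw [← h]
      rcases Nat.lt_or_ge k n with h1 | h1
      · have : n - k = (n - (k + 1)) + 1 := by omega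
        rw [this, pow_succ]
        ring
      · rw [hJc0 n (k + 1) (by omega)]
        ring
    · let a : ℕ → ℂ := fun k => qint q k * (z + qint q⁻¹ k)
      let d : ℕ → ℂ := fun k => Nat.casesOn k 0 (fun j => JS n j)
      have hX : (Polynomial.X : Polynomial ℂ) ^ (n + 1) =
          ∑ k ∈ Finset.range (n + 2), Polynomial.C (d k + a k * JS n k) * jsPoly q z k := by
        have e1 : ∑ k ∈ Finset.range (n + 2), Polynomial.C (d k) * jsPoly q z k =
            ∑ k ∈ Finset.range (n + 1), Polynomial.C (JS n k) * jsPoly q z (k + 1) := by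
          rw [Finset.sum_range_succ']
          simp [d]
        have e2 : ∑ k ∈ Finset.range (n + 2), Polynomial.C (a k * JS n k) * jsPoly q z k =
            ∑ k ∈ Finset.range (n + 1), Polynomial.C (a k * JS n k) * jsPoly q z k := by
          rw [Finset.sum_range_succ, hJS0 n (n + 1) (by omega)]
          simp
        simp only [Polynomial.C_add, add_mul, Finset.sum_add_distrib]
        rw [e1, e2, ← Finset.sum_add_distrib, pow_succ, hJS n, Finset.sum_mul]
        refine Finset.sum_congr rfl fun j _ => ?_
        rw [jsPoly_succ_aux, Polynomial.C_mul (a := a j)]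
        simp only [a]
        ring
      have h0 : ∑ k ∈ Finset.range (n + 2),
          Polynomial.C (JS (n + 1) k - (d k + a k * JS n k)) * jsPoly q z k = 0 := by
        simp only [Polynomial.C_sub, sub_mul, Finset.sum_sub_distrib]
        rw [← hX, ← hJS (n + 1), sub_self]
      have := jsPoly_indep_aux q z _ _ h0 (k + 1) (by omega)
      exact sub_eq_zero.mp this
end

section
/- For every q ∈ ℂ with q ≠ 0, every z ∈ ℂ, and every integer k ≥ 0, one has the identity of formal power series in ℂ[[x]]: Σ_{n ≥ k} JS_n^k(z;q)·x^n = ∏_{i=1}^{k} ( x · (1 − [i]_q([i]_{q⁻¹} + z)·x)^{-1} ), where (1 − c·x)^{-1} denotes the formal inverse Σ_{m ≥ 0} c^m x^m. -/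
lemma js_indep (q z : ℂ) (N : ℕ) (c : ℕ → ℂ)
    (h : ∑ k ∈ Finset.range N, Polynomial.C (c k) * jsPoly q z k = 0) :
    ∀ k < N, c k = 0 := by
  have hmon : ∀ k, (jsPoly q z k).Monic := fun k =>
    Polynomial.monic_prod_of_monic _ _ (fun i _ => Polynomial.monic_X_sub_C _)
  have hdeg : ∀ k, (jsPoly q z k).natDegree = k := by
    intro k
    unfold jsPoly
    rw [Polynomial.natDegree_prod_of_monic _ _ (fun i _ => Polynomial.monic_X_sub_C _)]
    simp only [Polynomial.natDegree_X_sub_C]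
    simp
  induction N with
  | zero => intro k hk; omega
  | succ N ih =>
    have hN : c N = 0 := by
      have h1 := congrArg (fun p => Polynomial.coeff p N) h
      simp only [Polynomial.finsetSum_coeff, Polynomial.coeff_C_mul, Polynomial.coeff_zero] at h1
      rw [Finset.sum_range_succ, Finset.sum_eq_zero] at h1
      · have h2 : (jsPoly q z N).coeff N = 1 := by
          have := (hmon N).coeff_natDegree
          rwa [hdeg] at this
        simpa [h2] using h1
      · intro k hk
        rw [Polynomial.coeff_eq_zero_of_natDegree_lt, mul_zero]
        rw [hdeg]; exact Finset.mem_range.mp hk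
    rw [Finset.sum_range_succ, hN] at h
    intro k hk
    rcases Nat.lt_succ_iff_lt_or_eq.mp hk with h1 | h1
    · exact ih (by simpa using h) k h1
    · rw [h1, hN]

lemma js_rec (q z : ℂ) (JS : ℕ → ℕ → ℂ)
    (hJS : ∀ m : ℕ, (Polynomial.X : Polynomial ℂ) ^ m =
      ∑ k ∈ Finset.range (m + 1), Polynomial.C (JS m k) * jsPoly q z k)
    (hJS0 : ∀ m k : ℕ, m < k → JS m k = 0) (n k : ℕ) :
    JS (n + 1) k = (if k = 0 then 0 else JS n (k - 1)) +
      qint q k * (z + qint q⁻¹ k) * JS n k := by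
  by_cases hk : k < n + 2
  · have key := js_indep q z (n + 2) (fun k => JS (n + 1) k -
      ((if k = 0 then 0 else JS n (k - 1)) + qint q k * (z + qint q⁻¹ k) * JS n k)) ?_ k hk
    · exact sub_eq_zero.mp key
    · simp only [Polynomial.C_sub, Polynomial.C_add, sub_mul, add_mul, Finset.sum_sub_distrib,
        Finset.sum_add_distrib]
      rw [← hJS (n + 1), sub_eq_zero, Finset.sum_range_succ' _ (n + 1),
        Finset.sum_range_succ _ (n + 1), hJS0 n (n + 1) (by omega), pow_succ, hJS n,
        Finset.sum_mul]
      simp only [if_true, Nat.add_eq_zero_iff, one_ne_zero, and_false, if_false,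
        Nat.add_sub_cancel, Polynomial.C_0, zero_mul, mul_zero, add_zero]
      rw [← Finset.sum_add_distrib]
      refine Finset.sum_congr rfl fun k _ => ?_
      have : jsPoly q z (k + 1) = jsPoly q z k *
          (Polynomial.X - Polynomial.C (qint q k * (z + qint q⁻¹ k))) := by
        unfold jsPoly; rw [Finset.prod_range_succ]
      rw [this, Polynomial.C_mul (b := JS n k)]
      ring
  · rw [hJS0 _ _ (by omega), hJS0 n k (by omega), if_neg (by omega), hJS0 n (k - 1) (by omega)]
    simp

lemma geom_inv (c : ℂ) (F G : PowerSeries ℂ)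
    (h : F = PowerSeries.X * G + PowerSeries.C c * PowerSeries.X * F) :
    F = G * (PowerSeries.X * PowerSeries.mk (fun m => c ^ m)) := by
  have h1 : PowerSeries.mk (fun m => c ^ m) * (1 - PowerSeries.C c * PowerSeries.X) = 1 := by
    rw [mul_sub, mul_one, mul_left_comm]
    ext n
    cases n with
    | zero => simp
    | succ n => simp [PowerSeries.coeff_succ_mul_X, PowerSeries.coeff_one, pow_succ, mul_comm]
  linear_combination F * (-h1) + PowerSeries.mk (fun m => c ^ m) * h

/-- the ordinary generating function of the `q`-Jacobi-Stirling numbers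
of the second kind: `∑_{n≥k} JS_n^k(z;q) x^n = ∏_{i=1}^{k} x·(1 - [i]_q([i]_{q⁻¹}+z)x)⁻¹`,
where the formal inverse `(1 - c x)⁻¹` is the power series `∑_{m≥0} c^m x^m`. -/
theorem statement10 (q : ℂ) (hq : q ≠ 0) (z : ℂ) (JS : ℕ → ℕ → ℂ)
    (hJS : ∀ m : ℕ, (Polynomial.X : Polynomial ℂ) ^ m =
      ∑ k ∈ Finset.range (m + 1), Polynomial.C (JS m k) * jsPoly q z k)
    (hJS0 : ∀ m k : ℕ, m < k → JS m k = 0) :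
    ∀ k : ℕ,
      (PowerSeries.mk (fun n => JS n k) : PowerSeries ℂ) =
        ∏ i ∈ Finset.Icc 1 k,
          (PowerSeries.X : PowerSeries ℂ) *
            PowerSeries.mk (fun m => (qint q i * (qint q⁻¹ i + z)) ^ m) := by
  have hrec := js_rec q z JS hJS hJS0
  intro k
  induction k with
  | zero =>
    ext n
    cases n with
    | zero =>
      have h := hJS 0
      simp only [pow_zero, zero_add, Finset.sum_range_one, jsPoly, Finset.range_zero,
        Finset.prod_empty, mul_one] at h
      have h2 : JS 0 0 = 1 := by
        have := congrArg (fun p => Polynomial.coeff p 0) h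
        simpa using this.symm
      simp [h2]
    | succ n => simp [hrec, qint, PowerSeries.coeff_one]
  | succ k ih =>
    rw [Finset.prod_Icc_succ_top (by omega), ← ih]
    apply geom_inv
    ext n
    cases n with
    | zero => simp [hJS0, mul_assoc]
    | succ n =>
      rw [mul_assoc]
      simp only [map_add, PowerSeries.coeff_C_mul, PowerSeries.coeff_succ_X_mul,
        PowerSeries.coeff_mk]
      rw [hrec n (k + 1)]
      simp [add_comm z]
end

section
/- Regard JS_n^k(z;q) and Jc_n^k(z;q) as elements of R[z], where R = ℤ[q, q⁻¹] is the ring of Laurent polynomials in q, defined by Jc_0^0 = JS_0^0 = 1, Jc_n^k = JS_n^k = 0 for k > n or k < 0, and the recurrences Jc_{n+1}^{k+1} = Jc_n^k + [n]_q(z + [n]_{q⁻¹})Jc_n^{k+1} and JS_{n+1}^{k+1} = JS_n^k + [k+1]_q(z + [k+1]_{q⁻¹})JS_n^{k+1}. Then for all integers n ≥ k ≥ 1: JS_n^k(z;q) and Jc_n^k(z;q) are polynomials in z of degree exactly n−k; every coefficient a_{n,k}^{(i)}(q) of z^i in JS_n^k(z;q) and every coefficient b_{n,k}^{(i)}(q)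 of z^i in Jc_n^k(z;q) is a Laurent polynomial in q with nonnegative integer coefficients; and the leading coefficients are a_{n,k}^{(n−k)}(q) = S_q(n,k) and b_{n,k}^{(n−k)}(q) = c_q(n,k). -/
/-- `[n]_q := ∑_{i=0}^{n-1} T^i` in the ring `ℤ[q,q⁻¹]` of Laurent polynomials. -/
noncomputable def qintL (n : ℕ) : LaurentPolynomial ℤ :=
  ∑ i ∈ Finset.range n, LaurentPolynomial.T (i : ℤ)

/-- `[n]_{q⁻¹} := ∑_{i=0}^{n-1} T^{-i}` in `ℤ[q,q⁻¹]`. -/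
noncomputable def qintLinv (n : ℕ) : LaurentPolynomial ℤ :=
  ∑ i ∈ Finset.range n, LaurentPolynomial.T (-(i : ℤ))

/-- The additive submonoid of `ℤ[q,q⁻¹]` consisting of the Laurent polynomials with
nonnegative integer coefficients (the ℕ-linear combinations of the powers `T^m`). -/
noncomputable def nonnegLaurent : AddSubmonoid (LaurentPolynomial ℤ) :=
  AddSubmonoid.closure (Set.range fun m : ℤ => (LaurentPolynomial.T m : LaurentPolynomial ℤ))

open Polynomial in
theorem aux_coeff_zero {R : Type*} [CommRing R] (a b : R) (P : R[X]) :
    (C a * (X + C b) * P).coeff 0 = a * (b * P.coeff 0) := by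
  rw [mul_assoc, coeff_C_mul, add_mul, coeff_add, coeff_C_mul, coeff_X_mul_zero, zero_add]

open Polynomial in
theorem aux_coeff_succ {R : Type*} [CommRing R] (a b : R) (P : R[X]) (i : ℕ) :
    (C a * (X + C b) * P).coeff (i + 1) = a * (P.coeff i + b * P.coeff (i + 1)) := by
  rw [mul_assoc, coeff_C_mul, add_mul, coeff_add, coeff_C_mul, coeff_X_mul]

theorem nonneg_T (m : ℤ) : (LaurentPolynomial.T m : LaurentPolynomial ℤ) ∈ nonnegLaurent :=
  AddSubmonoid.subset_closure ⟨m, rfl⟩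

theorem nonneg_one : (1 : LaurentPolynomial ℤ) ∈ nonnegLaurent := by
  rw [← LaurentPolynomial.T_zero]; exact nonneg_T 0

theorem nonneg_mul {x y : LaurentPolynomial ℤ} (hx : x ∈ nonnegLaurent)
    (hy : y ∈ nonnegLaurent) : x * y ∈ nonnegLaurent := by
  unfold nonnegLaurent at hx
  induction hx using AddSubmonoid.closure_induction with
  | mem x hx =>
    obtain ⟨m, rfl⟩ := hx
    unfold nonnegLaurent at hy
    induction hy using AddSubmonoid.closure_induction with
    | mem y hy =>
      obtain ⟨l, rfl⟩ := hy
      simp only [← LaurentPolynomial.T_add]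
      exact nonneg_T _
    | zero => rw [mul_zero]; exact zero_mem _
    | add u v _ _ hu hv => rw [mul_add]; exact add_mem hu hv
  | zero => rw [zero_mul]; exact zero_mem _
  | add u v _ _ hu hv => rw [add_mul]; exact add_mem hu hv

theorem nonneg_qintL (n : ℕ) : qintL n ∈ nonnegLaurent :=
  sum_mem fun _ _ => nonneg_T _

theorem nonneg_qintLinv (n : ℕ) : qintLinv n ∈ nonnegLaurent :=
  sum_mem fun _ _ => nonneg_T _

/-- Evaluation at `q = 1`. -/
noncomputable def evalOne : LaurentPolynomial ℤ →+* ℤ :=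
  LaurentPolynomial.eval₂ (RingHom.id ℤ) (1 : ℤˣ)

theorem evalOne_T (m : ℤ) : evalOne (LaurentPolynomial.T m) = 1 := by
  simp [evalOne]

theorem evalOne_qintL (n : ℕ) : evalOne (qintL n) = n := by
  simp [qintL, evalOne_T]

theorem aux_main (J : ℕ → ℕ → Polynomial (LaurentPolynomial ℤ))
    (S : ℕ → ℕ → LaurentPolynomial ℤ) (a b : ℕ → ℕ → LaurentPolynomial ℤ)
    (ha : ∀ n k, a n k ∈ nonnegLaurent) (hb : ∀ n k, b n k ∈ nonnegLaurent)
    (hpos : ∀ n k, k < n → 0 < evalOne (a n k))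
    (hJ00 : J 0 0 = 1) (hJ0 : ∀ n k : ℕ, n < k → J n k = 0)
    (hJcol : ∀ n : ℕ, 0 < n → J n 0 = 0)
    (hJrec : ∀ n k : ℕ, J (n + 1) (k + 1) =
      J n k + Polynomial.C (a n k) * (Polynomial.X + Polynomial.C (b n k)) * J n (k + 1))
    (hS00 : S 0 0 = 1) (hS0 : ∀ n k : ℕ, n < k → S n k = 0)
    (hScol : ∀ n : ℕ, 0 < n → S n 0 = 0)
    (hSrec : ∀ n k : ℕ, S (n + 1) (k + 1) = S n k + a n k * S n (k + 1))
    (n k : ℕ) (hk : 1 ≤ k) (hkn : k ≤ n) :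
    (J n k).degree = ((n - k : ℕ) : WithBot ℕ) ∧
      (∀ i : ℕ, (J n k).coeff i ∈ nonnegLaurent) ∧ (J n k).coeff (n - k) = S n k := by
  have h1 : ∀ n k i, (J n k).coeff i ∈ nonnegLaurent := by
    intro n
    induction n with
    | zero =>
      intro k i
      rcases k with _ | k
      · rw [hJ00, Polynomial.coeff_one]
        split_ifs
        · exact nonneg_one
        · exact zero_mem _
      · rw [hJ0 _ _ (by omega)]; exact zero_mem _
    | succ n ih =>
      intro k i
      rcases k with _ | k
      · rw [hJcol _ (by omega)]; exact zero_mem _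
      · rw [hJrec, Polynomial.coeff_add]
        refine add_mem (ih _ _) ?_
        rcases i with _ | i
        · rw [aux_coeff_zero]
          exact nonneg_mul (ha _ _) (nonneg_mul (hb _ _) (ih _ _))
        · rw [aux_coeff_succ]
          exact nonneg_mul (ha _ _) (add_mem (ih _ _) (nonneg_mul (hb _ _) (ih _ _)))
  have h2 : ∀ n k i, n < i + k → (J n k).coeff i = 0 := by
    intro n
    induction n with
    | zero =>
      intro k i h
      rcases k with _ | k
      · rw [hJ00, Polynomial.coeff_one, if_neg (by omega)]
      · rw [hJ0 _ _ (by omega), Polynomial.coeff_zero]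
    | succ n ih =>
      intro k i h
      rcases k with _ | k
      · rw [hJcol _ (by omega), Polynomial.coeff_zero]
      · rw [hJrec, Polynomial.coeff_add, ih k i (by omega)]
        rcases i with _ | i
        · rw [aux_coeff_zero, ih (k + 1) 0 (by omega)]; ring
        · rw [aux_coeff_succ, ih (k + 1) i (by omega), ih (k + 1) (i + 1) (by omega)]; ring
  have h3 : ∀ n k i, n = i + k → (J n k).coeff i = S n k := by
    intro n
    induction n with
    | zero =>
      intro k i h
      obtain rfl : k = 0 := by omega
      obtain rfl : i = 0 := by omega
      rw [hJ00, hS00, Polynomial.coeff_one, if_pos rfl]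
    | succ n ih =>
      intro k i h
      rcases k with _ | k
      · rw [hJcol _ (by omega), hScol _ (by omega), Polynomial.coeff_zero]
      · rw [hJrec, hSrec, Polynomial.coeff_add, ih k i (by omega)]
        rcases i with _ | i
        · rw [aux_coeff_zero, h2 n (k + 1) 0 (by omega), hS0 n (k + 1) (by omega)]; ring
        · rw [aux_coeff_succ, ih (k + 1) i (by omega), h2 n (k + 1) (i + 1) (by omega)]; ring
  have h4 : ∀ n k, k ≤ n → 0 ≤ evalOne (S n k) ∧ (1 ≤ k ∨ n = 0 → 0 < evalOne (S n k)) := by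
    intro n
    induction n with
    | zero =>
      intro k h
      obtain rfl : k = 0 := by omega
      simp [hS00]
    | succ n ih =>
      intro k h
      rcases k with _ | k
      · simp [hScol]
      · suffices 0 < evalOne (S (n + 1) (k + 1)) from ⟨this.le, fun _ => this⟩
        rw [hSrec, map_add, map_mul]
        rcases Nat.lt_or_ge k n with hlt | hge
        · have e1 := (ih k (by omega)).1
          have e2 := (ih (k + 1) (by omega)).2 (Or.inl (by omega))
          have e3 := hpos n k hlt
          positivity
        · rw [hS0 n (k + 1) (by omega), map_zero, mul_zero, add_zero]
          exact (ih k (by omega)).2 (by omega)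
  have h5 := h3 n k (n - k) (by omega)
  refine ⟨?_, h1 n k, h5⟩
  refine le_antisymm ?_ ?_
  · rw [Polynomial.degree_le_iff_coeff_zero]
    intro m hm
    have : n - k < m := by exact_mod_cast hm
    exact h2 n k m (by omega)
  · refine Polynomial.le_degree_of_ne_zero ?_
    rw [h5]
    intro h0
    have := (h4 n k hkn).2 (Or.inl hk)
    rw [h0, map_zero] at this
    exact lt_irrefl _ this

/-- Theorem 2.4 of the paper: regarding `JS_n^k(z;q)` and `Jc_n^k(z;q)`
as polynomials in `z` over `ℤ[q,q⁻¹]` (defined through their triangular recurrences), for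
`n ≥ k ≥ 1` they have degree exactly `n-k`, all their coefficients are Laurent polynomials
in `q` with nonnegative integer coefficients, and their leading coefficients are the
`q`-Stirling numbers `S_q(n,k)` and `c_q(n,k)` respectively. -/
theorem statement11
    (JS Jc : ℕ → ℕ → Polynomial (LaurentPolynomial ℤ))
    (Sq cq : ℕ → ℕ → LaurentPolynomial ℤ)
    (hJS00 : JS 0 0 = 1) (hJc00 : Jc 0 0 = 1)
    (hJS0 : ∀ n k : ℕ, n < k → JS n k = 0) (hJc0 : ∀ n k : ℕ, n < k → Jc n k = 0)
    (hJScol : ∀ n : ℕ, 0 < n → JS n 0 = 0) (hJccol : ∀ n : ℕ, 0 < n → Jc n 0 = 0)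
    (hJSrec : ∀ n k : ℕ, JS (n + 1) (k + 1) =
      JS n k + Polynomial.C (qintL (k + 1)) *
        (Polynomial.X + Polynomial.C (qintLinv (k + 1))) * JS n (k + 1))
    (hJcrec : ∀ n k : ℕ, Jc (n + 1) (k + 1) =
      Jc n k + Polynomial.C (qintL n) *
        (Polynomial.X + Polynomial.C (qintLinv n)) * Jc n (k + 1))
    (hS00 : Sq 0 0 = 1) (hc00 : cq 0 0 = 1)
    (hS0 : ∀ n k : ℕ, n < k → Sq n k = 0) (hc0 : ∀ n k : ℕ, n < k → cq n k = 0)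
    (hScol : ∀ n : ℕ, 0 < n → Sq n 0 = 0) (hccol : ∀ n : ℕ, 0 < n → cq n 0 = 0)
    (hSrec : ∀ n k : ℕ, Sq (n + 1) (k + 1) = Sq n k + qintL (k + 1) * Sq n (k + 1))
    (hcrec : ∀ n k : ℕ, cq (n + 1) (k + 1) = cq n k + qintL n * cq n (k + 1)) :
    ∀ n k : ℕ, 1 ≤ k → k ≤ n →
      (JS n k).degree = ((n - k : ℕ) : WithBot ℕ) ∧
      (Jc n k).degree = ((n - k : ℕ) : WithBot ℕ) ∧
      (∀ i : ℕ, (JS n k).coeff i ∈ nonnegLaurent) ∧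
      (∀ i : ℕ, (Jc n k).coeff i ∈ nonnegLaurent) ∧
      (JS n k).coeff (n - k) = Sq n k ∧
      (Jc n k).coeff (n - k) = cq n k := by
  intro n k hk hkn
  obtain ⟨a1, a2, a3⟩ := aux_main JS Sq (fun _ k => qintL (k + 1)) (fun _ k => qintLinv (k + 1))
    (fun _ _ => nonneg_qintL _) (fun _ _ => nonneg_qintLinv _)
    (fun n k h => by simp only [evalOne_qintL]; exact_mod_cast Nat.succ_pos k)
    hJS00 hJS0 hJScol hJSrec hS00 hS0 hScol hSrec n k hk hkn
  obtain ⟨b1, b2, b3⟩ := aux_main Jc cq (fun n _ => qintL n) (fun n _ => qintLinv n)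
    (fun _ _ => nonneg_qintL _) (fun _ _ => nonneg_qintLinv _)
    (fun n k h => by simp only [evalOne_qintL]; exact_mod_cast (by omega : 0 < n))
    hJc00 hJc0 hJccol hJcrec hc00 hc0 hccol hcrec n k hk hkn
  exact ⟨a1, b1, a2, b2, a3, b3⟩
end

section
/- For every q ∈ ℂ with q ≠ 0 and q ≠ 1, and all integers 0 ≤ k ≤ n: JS_n^k(1/(q−1); q⁻¹) = (q/(q−1))^{n−k}·S_q(n,k) and Jc_n^k(1/(q−1); q⁻¹) = (q/(q−1))^{n−k}·c_q(n,k). -/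
/-- `∏_{i=0}^{k-1}(x - [i]_q)`, the basis defining the `q`-Stirling numbers. -/
noncomputable def sPoly (q : ℂ) (k : ℕ) : Polynomial ℂ :=
  ∏ i ∈ Finset.range k, (Polynomial.X - Polynomial.C (qint q i))

open Polynomial in
theorem aux_indep (P : ℕ → Polynomial ℂ) (hm : ∀ k, (P k).Monic) (hd : ∀ k, (P k).natDegree = k)
    (u v : ℕ → ℂ) (N : ℕ)
    (h : ∑ k ∈ Finset.range N, C (u k) * P k = ∑ k ∈ Finset.range N, C (v k) * P k) :
    ∀ k < N, u k = v k := by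
  induction N with
  | zero => intro k hk; omega
  | succ N ih =>
    have key : ∀ w : ℕ → ℂ, (∑ k ∈ Finset.range (N + 1), C (w k) * P k).coeff N = w N := by
      intro w
      rw [Finset.sum_range_succ, coeff_add, finsetSum_coeff, Finset.sum_eq_zero, zero_add,
        coeff_C_mul]
      · have := (hm N).coeff_natDegree
        rw [hd] at this
        rw [this, mul_one]
      · intro k hk
        rw [coeff_C_mul, coeff_eq_zero_of_natDegree_lt, mul_zero]
        rw [hd]; exact Finset.mem_range.mp hk
    have hN : u N = v N := by rw [← key u, h, key v]
    rw [Finset.sum_range_succ, Finset.sum_range_succ, hN] at h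
    intro k hk
    rcases Nat.lt_succ_iff_lt_or_eq.mp hk with h1 | h1
    · exact ih (add_right_cancel h) k h1
    · rw [h1, hN]

theorem aux_root (q : ℂ) (hq0 : q ≠ 0) (hq1 : q ≠ 1) (i : ℕ) :
    qint q⁻¹ i * (1 / (q - 1) + qint q⁻¹⁻¹ i) = q / (q - 1) * qint q i := by
  have h1 : q - 1 ≠ 0 := sub_ne_zero.mpr hq1
  have h2 : q⁻¹ ≠ 1 := by simpa using hq1
  have h3 : (1 : ℂ) - q ≠ 0 := sub_ne_zero.mpr hq1.symm
  have h4 : q⁻¹ - 1 ≠ 0 := sub_ne_zero.mpr h2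
  have h5 : q ^ i ≠ 0 := pow_ne_zero _ hq0
  have h6 : q⁻¹ - 1 = -(q - 1) / q := by field_simp; ring
  rw [inv_inv]
  unfold qint
  rw [geom_sum_eq hq1, geom_sum_eq h2, h6, inv_pow]
  field_simp
  ring

open Polynomial in
theorem aux_comp (q : ℂ) (hq0 : q ≠ 0) (hq1 : q ≠ 1) (k : ℕ) :
    (jsPoly q⁻¹ (1 / (q - 1)) k).comp (C (q / (q - 1)) * X) =
      C ((q / (q - 1)) ^ k) * sPoly q k := by
  unfold jsPoly sPoly
  induction k with
  | zero => simp
  | succ k ih =>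
    rw [Finset.prod_range_succ, Finset.prod_range_succ, mul_comp, ih, aux_root q hq0 hq1]
    simp only [sub_comp, X_comp, C_comp, pow_succ, C_mul, mul_comp]
    ring

/-- formula (2.14) of the paper: specialising the `q⁻¹`-Jacobi-Stirling
numbers at `z = 1/(q-1)` recovers the `q`-Stirling numbers up to the factor
`(q/(q-1))^{n-k}`. -/
theorem statement12 (q : ℂ) (hq0 : q ≠ 0) (hq1 : q ≠ 1)
    (cq Sq Jc JS : ℕ → ℕ → ℂ)
    (hc : ∀ m : ℕ, sPoly q m =
      ∑ k ∈ Finset.range (m + 1),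
        Polynomial.C ((-1 : ℂ) ^ (m - k) * cq m k) * Polynomial.X ^ k)
    (hS : ∀ m : ℕ, (Polynomial.X : Polynomial ℂ) ^ m =
      ∑ k ∈ Finset.range (m + 1), Polynomial.C (Sq m k) * sPoly q k)
    (hJc : ∀ m : ℕ, jsPoly q⁻¹ (1 / (q - 1)) m =
      ∑ k ∈ Finset.range (m + 1),
        Polynomial.C ((-1 : ℂ) ^ (m - k) * Jc m k) * Polynomial.X ^ k)
    (hJS : ∀ m : ℕ, (Polynomial.X : Polynomial ℂ) ^ m =
      ∑ k ∈ Finset.range (m + 1), Polynomial.C (JS m k) * jsPoly q⁻¹ (1 / (q - 1)) k) :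
    ∀ n k : ℕ, k ≤ n →
      JS n k = (q / (q - 1)) ^ (n - k) * Sq n k ∧
      Jc n k = (q / (q - 1)) ^ (n - k) * cq n k := by
  have ha : q / (q - 1) ≠ 0 := div_ne_zero hq0 (sub_ne_zero.mpr hq1)
  have hcomp := aux_comp q hq0 hq1
  set a := q / (q - 1) with hadef
  have cancel : ∀ n k : ℕ, k ≤ n → ∀ x y : ℂ, x * a ^ k = a ^ n * y → x = a ^ (n - k) * y := by
    intro n k hk x y h
    apply mul_right_cancel₀ (pow_ne_zero k ha)
    rw [h, ← Nat.sub_add_cancel hk, pow_add, Nat.add_sub_cancel]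
    ring
  intro n k hk
  constructor
  · apply cancel n k hk
    refine aux_indep (sPoly q) (fun k => ?_) (fun k => ?_) (fun k => JS n k * a ^ k)
      (fun k => a ^ n * Sq n k) (n + 1) ?_ k (by omega)
    · exact Polynomial.monic_prod_X_sub_C _ _
    · unfold sPoly
      rw [Polynomial.natDegree_finsetProd_X_sub_C_eq_card, Finset.card_range]
    · have h1 := congrArg (fun p => p.comp (Polynomial.C a * Polynomial.X)) (hJS n)
      simp only [Polynomial.sum_comp, Polynomial.mul_comp, Polynomial.C_comp, hcomp,
        Polynomial.X_pow_comp, mul_pow] at h1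
      rw [hS n, Finset.mul_sum] at h1
      simp only [Polynomial.C_mul, Polynomial.C_pow, mul_assoc] at h1 ⊢
      exact h1.symm
  · apply cancel n k hk
    have h0 := aux_indep (fun k => Polynomial.X ^ k) (fun k => Polynomial.monic_X_pow k)
      (fun k => Polynomial.natDegree_X_pow k) (fun k => (-1) ^ (n - k) * Jc n k * a ^ k)
      (fun k => a ^ n * ((-1) ^ (n - k) * cq n k)) (n + 1) ?_ k (by omega)
    · have h2 : ((-1 : ℂ)) ^ (n - k) ≠ 0 := pow_ne_zero _ (by norm_num)
      apply mul_left_cancel₀ h2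
      linear_combination h0
    · have h1 := congrArg (fun p => p.comp (Polynomial.C a * Polynomial.X)) (hJc n)
      simp only [Polynomial.sum_comp, Polynomial.mul_comp, Polynomial.C_comp, hcomp,
        Polynomial.X_pow_comp, mul_pow] at h1
      rw [hc n, Finset.mul_sum] at h1
      simp only [Polynomial.C_mul, Polynomial.C_pow, mul_assoc] at h1 ⊢
      exact h1.symm
end

section
/- For all positive integers n and k with k ≤ n, every integer i with 0 ≤ i ≤ n−k, and every q ∈ ℂ with q ≠ 0: the coefficient a_{n,k}^{(i)}(q) of z^i in JS_n^k(z;q) equals Σ_{π ∈ Π(n,k,i)} q^{inv(π)}, the sum over all Jacobi-Stirling k-partitions π of [n]_2 whose zero block contains exactly i subscript-1 elements, of q raised to the inversion statistic inv(π). -/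
open scoped Classical

/-- A Jacobi-Stirling `k`-partition of `[n]₂` is encoded as the assignment
`f : Fin n × Bool → Fin (k+1)` sending each copy (`false` = subscript 1, `true` =
subscript 2) of each number `a+1`, `a : Fin n`, to the index of its block; block `0` is the
zero block, and the nonzero blocks are listed in increasing order of their minima. -/
def IsJSPartition (n k : ℕ) (f : Fin n × Bool → Fin (k + 1)) : Prop :=
  -- the zero block does not contain both copies of any number
  (∀ a : Fin n, ¬(f (a, false) = 0 ∧ f (a, true) = 0)) ∧
  -- each nonzero block is nonempty and contains both copies of its smallest number
  (∀ j : Fin (k + 1), j ≠ 0 →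
    ∃ m : Fin n, f (m, false) = j ∧ f (m, true) = j ∧
      ∀ a : Fin n, (f (a, false) = j ∨ f (a, true) = j) → m ≤ a) ∧
  -- each nonzero block contains at most one copy of any number other than its minimum
  (∀ j : Fin (k + 1), j ≠ 0 →
    ∀ a : Fin n, f (a, false) = j → f (a, true) = j →
      ∀ b : Fin n, (f (b, false) = j ∨ f (b, true) = j) → a ≤ b) ∧
  -- the nonzero blocks are indexed in increasing order of their minima
  (∀ j j' : Fin (k + 1), j ≠ 0 → j' ≠ 0 → j < j' →
    ∀ m m' : Fin n,
      (f (m, false) = j ∧ f (m, true) = j) →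
      (f (m', false) = j' ∧ f (m', true) = j') → m < m')

/-- The number of inversions of type 1: pairs `(b₁, B_j)` with `b₁ ∈ B_i`, `1 ≤ i < j`,
and `b > c` for some `c` with `c₁ ∈ B_j`. -/
noncomputable def inv1 (n k : ℕ) (f : Fin n × Bool → Fin (k + 1)) : ℕ :=
  (Finset.univ.filter fun p : Fin n × Fin (k + 1) =>
    f (p.1, false) ≠ 0 ∧ f (p.1, false) < p.2 ∧
      ∃ c : Fin n, f (c, false) = p.2 ∧ c < p.1).card

/-- The number of inversions of type 2: pairs `(b₂, B_j)` with `b₂ ∈ B_i`, `0 ≤ i < j`,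
`b > c` for some `c` with `c₂ ∈ B_j`, and `b₁ ∉ B_j`. -/
noncomputable def inv2 (n k : ℕ) (f : Fin n × Bool → Fin (k + 1)) : ℕ :=
  (Finset.univ.filter fun p : Fin n × Fin (k + 1) =>
    f (p.1, true) < p.2 ∧ (∃ c : Fin n, f (c, true) = p.2 ∧ c < p.1) ∧
      f (p.1, false) ≠ p.2).card

/-- `inv(π) := inv₂(π) - inv₁(π)`. -/
noncomputable def invStat (n k : ℕ) (f : Fin n × Bool → Fin (k + 1)) : ℤ :=
  (inv2 n k f : ℤ) - (inv1 n k f : ℤ)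

/-- Extend an assignment by prescribing the blocks of the two copies of the new largest number. -/
def jsExt {n : ℕ} {α : Type} (x y : α) (g : Fin n × Bool → α) : Fin (n + 1) × Bool → α :=
  fun p => Fin.lastCases (motive := fun _ => α) (if p.2 then y else x) (fun a => g (a, p.2)) p.1

@[simp] lemma jsExt_last_false {n : ℕ} {α : Type} (x y : α) (g : Fin n × Bool → α) :
    jsExt x y g (Fin.last n, false) = x := by simp [jsExt]

@[simp] lemma jsExt_last_true {n : ℕ} {α : Type} (x y : α) (g : Fin n × Bool → α) :
    jsExt x y g (Fin.last n, true) = y := by simp [jsExt]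

@[simp] lemma jsExt_castSucc {n : ℕ} {α : Type} (x y : α) (g : Fin n × Bool → α)
    (a : Fin n) (b : Bool) :
    jsExt x y g (a.castSucc, b) = g (a, b) := by simp [jsExt]

/-- The extension as an equivalence. -/
def jsExtEquiv (n : ℕ) (α : Type) :
    (α × α × (Fin n × Bool → α)) ≃ (Fin (n + 1) × Bool → α) where
  toFun t := jsExt t.1 t.2.1 t.2.2
  invFun f := (f (Fin.last n, false), f (Fin.last n, true), fun p => f (p.1.castSucc, p.2))
  left_inv t := by
    obtain ⟨x, y, g⟩ := t
    simp
  right_inv f := by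
    funext p
    obtain ⟨a, b⟩ := p
    induction a using Fin.lastCases with
    | last => cases b <;> simp
    | cast a => simp

lemma forall_fin_snoc {n : ℕ} {P : Fin (n + 1) → Prop} :
    (∀ a, P a) ↔ (∀ a : Fin n, P a.castSucc) ∧ P (Fin.last n) :=
  ⟨fun h => ⟨fun a => h _, h _⟩, fun h a => Fin.lastCases h.2 h.1 a⟩

lemma exists_fin_snoc {n : ℕ} {P : Fin (n + 1) → Prop} :
    (∃ a, P a) ↔ (∃ a : Fin n, P a.castSucc) ∨ P (Fin.last n) := by
  constructor
  · rintro ⟨a, ha⟩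
    induction a using Fin.lastCases with
    | last => exact Or.inr ha
    | cast a => exact Or.inl ⟨a, ha⟩
  · rintro (⟨a, ha⟩ | h)
    · exact ⟨_, ha⟩
    · exact ⟨_, h⟩

lemma js_ext_iff {n k : ℕ} {x y : Fin (k + 1)} (hxy : x ≠ y) (g : Fin n × Bool → Fin (k + 1)) :
    IsJSPartition (n + 1) k (jsExt x y g) ↔ IsJSPartition n k g := by
  have hl : ∀ a : Fin n, ¬ (Fin.last n ≤ a.castSucc) := fun a => by
    simp [Fin.le_def]
  have hxy1 : ∀ j, ¬ (x = j ∧ y = j) := fun j h => hxy (h.1.trans h.2.symm)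
  have hxy2 : ∀ j, x = j → y = j → False := fun j h h' => hxy (h.trans h'.symm)
  constructor
  · rintro ⟨h1, h2, h3, h4⟩
    refine ⟨fun a => by simpa using h1 a.castSucc, fun j hj => ?_, fun j hj a ha ha' b hb => ?_,
      fun j j' hj hj' hjj m m' hm hm' => ?_⟩
    · obtain ⟨m, hm, hm', hmin⟩ := h2 j hj
      induction m using Fin.lastCases with
      | last => simp at hm hm'; exact absurd (hm.trans hm'.symm) hxy
      | cast m =>
        refine ⟨m, by simpa using hm, by simpa using hm', fun a ha => ?_⟩
        simpa using hmin a.castSucc (by simpa using ha)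
    · simpa using h3 j hj a.castSucc (by simpa using ha) (by simpa using ha') b.castSucc
        (by simpa using hb)
    · simpa using h4 j j' hj hj' hjj m.castSucc m'.castSucc (by simpa using hm) (by simpa using hm')
  · rintro ⟨h1, h2, h3, h4⟩
    refine ⟨?_, fun j hj => ?_, fun j hj => ?_, fun j j' hj hj' hjj => ?_⟩
    · rw [forall_fin_snoc]
      simpa using ⟨fun a ha => by simpa [ha] using h1 a, fun h h' => hxy2 0 h h'⟩
    · obtain ⟨m, hm, hm', hmin⟩ := h2 j hj
      refine ⟨m.castSucc, by simpa using hm, by simpa using hm', ?_⟩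
      rw [forall_fin_snoc]
      exact ⟨fun a ha => by simpa using hmin a (by simpa using ha), fun _ => Fin.le_last _⟩
    · intro a
      induction a using Fin.lastCases with
      | last => intro h h'; simp at h h'; exact (hxy2 j h h').elim
      | cast a =>
        intro h h'
        rw [forall_fin_snoc]
        exact ⟨fun b hb => by
          simpa using h3 j hj a (by simpa using h) (by simpa using h') b (by simpa using hb),
          fun _ => Fin.le_last _⟩
    · intro m m' hm hm'
      induction m using Fin.lastCases with
      | last => simp at hm; exact (hxy2 j hm.1 hm.2).elim
      | cast m =>
        induction m' using Fin.lastCases with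
        | last => simp at hm'; exact (hxy2 j' hm'.1 hm'.2).elim
        | cast m' =>
          simpa using h4 j j' hj hj' hjj m m' (by simpa using hm) (by simpa using hm')

lemma js_diag {n k : ℕ} {x : Fin (k + 1)} {g : Fin n × Bool → Fin (k + 1)}
    (h : IsJSPartition (n + 1) k (jsExt x x g)) :
    x ≠ 0 ∧ x = Fin.last k ∧ ∀ p, g p ≠ x := by
  obtain ⟨h1, h2, h3, h4⟩ := h
  have hx : x ≠ 0 := fun hx => h1 (Fin.last n) (by simp [hx])
  refine ⟨hx, ?_, ?_⟩
  · by_contra hne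
    have hlt : x < Fin.last k := lt_of_le_of_ne (Fin.le_last _) hne
    have hk : Fin.last k ≠ 0 := fun h0 => by rw [h0] at hlt; simp at hlt
    obtain ⟨m, hm, hm', -⟩ := h2 (Fin.last k) hk
    have := h4 x _ hx hk hlt (Fin.last n) m (by simp) ⟨hm, hm'⟩
    exact absurd this (not_lt.mpr (Fin.le_last _))
  · rintro ⟨a, b⟩ hp
    have := h3 x hx (Fin.last n) (by simp) (by simp) a.castSucc (by cases b <;> simp [hp])
    simp [Fin.le_def] at this
    omega

lemma js_new_iff {n k : ℕ} (h : Fin n × Bool → Fin (k + 1)) :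
    IsJSPartition (n + 1) (k + 1)
      (jsExt (Fin.last (k + 1)) (Fin.last (k + 1)) (fun p => (h p).castSucc)) ↔
    IsJSPartition n k h := by
  have hl : ∀ j : Fin (k + 1), j.castSucc ≠ Fin.last (k + 1) := fun j => Fin.castSucc_ne_last j
  have hl' : ∀ j : Fin (k + 1), Fin.last (k + 1) ≠ j.castSucc := fun j => (hl j).symm
  have h0 : Fin.last (k + 1) ≠ 0 := by simp [Fin.ext_iff]
  have hc0 : ∀ j : Fin (k + 1), j.castSucc = 0 ↔ j = 0 := fun j => Fin.castSucc_eq_zero_iff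
  have hnl : ∀ j : Fin (k + 2), ¬ Fin.last (k + 1) < j := fun j => not_lt.mpr (Fin.le_last _)
  constructor
  · rintro ⟨h1, h2, h3, h4⟩
    refine ⟨fun a => by simpa [hc0] using h1 a.castSucc, fun j hj => ?_,
      fun j hj a ha ha' b hb => ?_, fun j j' hj hj' hjj m m' hm hm' => ?_⟩
    · obtain ⟨m, hm, hm', hmin⟩ := h2 j.castSucc (by simpa [hc0] using hj)
      induction m using Fin.lastCases with
      | last => simp at hm; exact absurd hm (hl' j)
      | cast m =>
        refine ⟨m, by simpa using hm, by simpa using hm', fun a ha => ?_⟩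
        simpa using hmin a.castSucc (by simpa using ha)
    · simpa using h3 j.castSucc (by simpa [hc0] using hj) a.castSucc (by simpa using ha)
        (by simpa using ha') b.castSucc (by simpa using hb)
    · simpa using h4 j.castSucc j'.castSucc (by simpa [hc0] using hj) (by simpa [hc0] using hj')
        (by simpa using hjj) m.castSucc m'.castSucc (by simpa using hm) (by simpa using hm')
  · rintro ⟨h1, h2, h3, h4⟩
    refine ⟨?_, fun j hj => ?_, fun j hj => ?_, fun j j' hj hj' hjj => ?_⟩
    · rw [forall_fin_snoc]
      refine ⟨fun a => by simpa [hc0] using h1 a, by simp [h0]⟩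
    · induction j using Fin.lastCases with
      | last =>
        refine ⟨Fin.last n, by simp, by simp, ?_⟩
        rw [forall_fin_snoc]
        refine ⟨fun a ha => ?_, fun _ => le_rfl⟩
        simp [hl] at ha
      | cast j =>
        obtain ⟨m, hm, hm', hmin⟩ := h2 j (by simpa [hc0] using hj)
        refine ⟨m.castSucc, by simpa using hm, by simpa using hm', ?_⟩
        rw [forall_fin_snoc]
        exact ⟨fun a ha => by simpa using hmin a (by simpa using ha), fun _ => Fin.le_last _⟩
    · intro a ha ha' b hb
      induction b using Fin.lastCases with
      | last => exact Fin.le_last _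
      | cast b =>
        induction j using Fin.lastCases with
        | last => simp [hl] at hb
        | cast j =>
          induction a using Fin.lastCases with
          | last => simp at ha; exact absurd ha (hl' j)
          | cast a =>
            simpa using h3 j (by simpa [hc0] using hj) a (by simpa using ha) (by simpa using ha') b
              (by simpa using hb)
    · intro m m' hm hm'
      induction j using Fin.lastCases with
      | last => exact absurd hjj (hnl _)
      | cast j =>
        induction m using Fin.lastCases with
        | last => simp at hm; exact absurd hm (hl' j)
        | cast m =>
          induction m' using Fin.lastCases with
          | last => exact Fin.castSucc_lt_last _
          | cast m' =>
            induction j' using Fin.lastCases with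
            | last => simp [hl] at hm'
            | cast j' =>
              simpa using h4 j j' (by simpa [hc0] using hj) (by simpa [hc0] using hj')
                (by simpa using hjj) m m' (by simpa using hm) (by simpa using hm')

/-- The number of subscript-1 elements in the zero block. -/
noncomputable def zcount (n k : ℕ) (f : Fin n × Bool → Fin (k + 1)) : ℕ :=
  (Finset.univ.filter fun a : Fin n => f (a, false) = 0).card

lemma zcount_ext {n k : ℕ} (x y : Fin (k + 1)) (g : Fin n × Bool → Fin (k + 1)) :
    zcount (n + 1) k (jsExt x y g) = zcount n k g + if x = 0 then 1 else 0 := by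
  simp only [zcount, Finset.card_filter, Fin.sum_univ_castSucc, jsExt_castSucc, jsExt_last_false]

lemma inv1_ext {n k : ℕ} (x y : Fin (k + 1)) (g : Fin n × Bool → Fin (k + 1))
    (hg : IsJSPartition n k g) :
    inv1 (n + 1) k (jsExt x y g) = inv1 n k g + if x = 0 then 0 else (Finset.Ioi x).card := by
  have hex : ∀ j : Fin (k + 1), j ≠ 0 → ∃ c, g (c, false) = j := fun j hj => by
    obtain ⟨m, hm, -⟩ := hg.2.1 j hj
    exact ⟨m, hm⟩
  simp only [inv1, Finset.card_filter, Fintype.sum_prod_type, Fin.sum_univ_castSucc (n := n),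
    jsExt_castSucc, jsExt_last_false, exists_fin_snoc, Fin.castSucc_lt_castSucc_iff,
    Fin.castSucc_lt_last, lt_irrefl, not_lt.mpr (Fin.le_last _), and_false, or_false, and_true]
  congr 1
  by_cases hx : x = 0
  · simp [hx]
  · simp only [hx, if_false, ne_eq, not_false_eq_true, true_and]
    rw [← Finset.card_filter]
    congr 1
    ext j
    simp only [Finset.mem_filter, Finset.mem_univ, true_and, Finset.mem_Ioi]
    exact ⟨fun h => h.1, fun h => ⟨h, hex j (fun h0 => by simp [h0] at h)⟩⟩

lemma inv2_ext {n k : ℕ} (x y : Fin (k + 1)) (g : Fin n × Bool → Fin (k + 1))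
    (hg : IsJSPartition n k g) :
    inv2 (n + 1) k (jsExt x y g) =
      inv2 n k g + (Finset.univ.filter fun j => y < j ∧ x ≠ j).card := by
  have hex : ∀ j : Fin (k + 1), j ≠ 0 → ∃ c, g (c, true) = j := fun j hj => by
    obtain ⟨m, -, hm, -⟩ := hg.2.1 j hj
    exact ⟨m, hm⟩
  simp only [inv2, Finset.card_filter, Fintype.sum_prod_type, Fin.sum_univ_castSucc (n := n),
    jsExt_castSucc, jsExt_last_false, jsExt_last_true, exists_fin_snoc,
    Fin.castSucc_lt_castSucc_iff,
    Fin.castSucc_lt_last, lt_irrefl, not_lt.mpr (Fin.le_last _), and_false, or_false, and_true]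
  congr 1
  refine Finset.sum_congr rfl fun j _ => ?_
  refine if_congr ?_ rfl rfl
  exact ⟨fun h => ⟨h.1, h.2.2⟩, fun h => ⟨h.1, hex j (fun h0 => by simp [h0] at h), h.2⟩⟩

lemma inv1_new {n k : ℕ} (h : Fin n × Bool → Fin (k + 1)) :
    inv1 (n + 1) (k + 1)
      (jsExt (Fin.last (k + 1)) (Fin.last (k + 1)) (fun p => (h p).castSucc)) = inv1 n k h := by
  have hc0 : ∀ j : Fin (k + 1), j.castSucc = 0 ↔ j = 0 := fun j => Fin.castSucc_eq_zero_iff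
  simp only [inv1, Finset.card_filter, Fintype.sum_prod_type, Fin.sum_univ_castSucc (n := n),
    jsExt_castSucc, jsExt_last_false, exists_fin_snoc, Fin.castSucc_lt_castSucc_iff,
    Fin.castSucc_lt_last, lt_irrefl, not_lt.mpr (Fin.le_last _), and_false, or_false, and_true,
    false_and, if_false, Finset.sum_const_zero, add_zero]
  refine Finset.sum_congr rfl fun b _ => ?_
  rw [Fin.sum_univ_castSucc]
  simp [hc0, Fin.castSucc_ne_last]

lemma inv2_new {n k : ℕ} (h : Fin n × Bool → Fin (k + 1)) :
    inv2 (n + 1) (k + 1)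
      (jsExt (Fin.last (k + 1)) (Fin.last (k + 1)) (fun p => (h p).castSucc)) = inv2 n k h := by
  simp only [inv2, Finset.card_filter, Fintype.sum_prod_type, Fin.sum_univ_castSucc (n := n),
    jsExt_castSucc, jsExt_last_false, jsExt_last_true, exists_fin_snoc,
    Fin.castSucc_lt_castSucc_iff,
    Fin.castSucc_lt_last, lt_irrefl, not_lt.mpr (Fin.le_last _), and_false, or_false, and_true,
    false_and, if_false, Finset.sum_const_zero, add_zero]
  refine Finset.sum_congr rfl fun b _ => ?_
  rw [Fin.sum_univ_castSucc]
  simp [Fin.castSucc_ne_last]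

lemma zcount_new {n k : ℕ} (h : Fin n × Bool → Fin (k + 1)) :
    zcount (n + 1) (k + 1)
      (jsExt (Fin.last (k + 1)) (Fin.last (k + 1)) (fun p => (h p).castSucc)) = zcount n k h := by
  have hc0 : ∀ j : Fin (k + 1), j.castSucc = 0 ↔ j = 0 := fun j => Fin.castSucc_eq_zero_iff
  have h0 : Fin.last (k + 1) ≠ 0 := by simp [Fin.ext_iff]
  rw [zcount_ext, if_neg h0]
  simp [zcount, hc0]

open Polynomial in
/-- The weight of an assignment. -/
noncomputable def jsW (q : ℂ) (n k : ℕ) (f : Fin n × Bool → Fin (k + 1)) : ℂ[X] :=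
  if IsJSPartition n k f then C (q ^ invStat n k f) * X ^ zcount n k f else 0

open Polynomial in
/-- The generating polynomial. -/
noncomputable def jsG (q : ℂ) (n k : ℕ) : ℂ[X] :=
  ∑ f : Fin n × Bool → Fin (k + 1), jsW q n k f

open Polynomial in
/-- The weight of the position of the largest number. -/
noncomputable def posW (q : ℂ) (k : ℕ) (x y : Fin (k + 1)) : ℂ[X] :=
  C (q ^ (Finset.univ.filter fun j => y < j ∧ x ≠ j).card) *
    (if x = 0 then X else C (q⁻¹ ^ (Finset.Ioi x).card))

open Polynomial in
lemma jsW_ext (q : ℂ) (hq : q ≠ 0) {n k : ℕ} {x y : Fin (k + 1)} (hxy : x ≠ y)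
    (g : Fin n × Bool → Fin (k + 1)) :
    jsW q (n + 1) k (jsExt x y g) = posW q k x y * jsW q n k g := by
  unfold jsW
  by_cases hg : IsJSPartition n k g
  · rw [if_pos ((js_ext_iff hxy g).2 hg), if_pos hg, invStat, inv1_ext x y g hg, inv2_ext x y g hg,
      zcount_ext, posW, invStat]
    by_cases hx : x = 0
    · simp only [hx, if_true, Nat.cast_add, Nat.cast_zero, add_zero, pow_succ]
      rw [add_sub_right_comm, zpow_add₀ hq, zpow_natCast, C_mul]
      ring
    · simp only [hx, if_false, add_zero, Nat.cast_add]
      rw [add_sub_add_comm, zpow_add₀ hq, zpow_sub₀ hq _ ((Finset.Ioi x).card : ℤ), zpow_natCast,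
        zpow_natCast, inv_pow, div_eq_mul_inv, C_mul, C_mul]
      ring
  · rw [if_neg (fun h => hg ((js_ext_iff hxy g).1 h)), if_neg hg, mul_zero]

lemma jsW_new (q : ℂ) {n k : ℕ} (h : Fin n × Bool → Fin (k + 1)) :
    jsW q n k h = jsW q (n + 1) (k + 1)
      (jsExt (Fin.last (k + 1)) (Fin.last (k + 1)) (fun p => (h p).castSucc)) := by
  unfold jsW invStat
  rw [inv1_new, inv2_new, zcount_new]
  simp only [js_new_iff]

lemma diag_zero (q : ℂ) (n : ℕ) :
    ∑ x : Fin 1, ∑ g : Fin n × Bool → Fin 1, jsW q (n + 1) 0 (jsExt x x g) = 0 := by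
  refine Finset.sum_eq_zero fun x _ => Finset.sum_eq_zero fun g _ => ?_
  unfold jsW
  rw [if_neg]
  intro h
  exact (js_diag h).1 (Subsingleton.elim (α := Fin 1) _ _)

lemma diag_succ (q : ℂ) (n k : ℕ) :
    ∑ x : Fin (k + 2), ∑ g : Fin n × Bool → Fin (k + 2), jsW q (n + 1) (k + 1) (jsExt x x g) =
      jsG q n k := by
  rw [Finset.sum_eq_single (Fin.last (k + 1))]
  · symm
    unfold jsG
    refine Fintype.sum_of_injective (fun h p => (h p).castSucc) ?_ _ _ ?_ (fun h => jsW_new q h)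
    · intro a b hab
      funext p
      exact Fin.castSucc_injective _ (congrFun hab p)
    · intro g hg
      unfold jsW
      rw [if_neg]
      intro h
      apply hg
      refine ⟨fun p => (g p).castPred ((js_diag h).2.2 p), ?_⟩
      funext p
      simp
  · intro x _ hx
    refine Finset.sum_eq_zero fun g _ => ?_
    unfold jsW
    rw [if_neg]
    intro h
    exact hx (js_diag h).2.1
  · simp

lemma qint_rev (q : ℂ) (k : ℕ) : ∑ y : Fin k, q ^ (Finset.Ioi y).card = qint q k := by
  simp only [Fin.card_Ioi, qint]
  rw [← Finset.sum_range_reflect, ← Fin.sum_univ_eq_sum_range (fun i => q ^ (k - 1 - i))]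

lemma card_above {k : ℕ} (x : Fin (k + 1)) (y : Fin k) :
    (Finset.univ.filter fun j => x.succAbove y < j ∧ x ≠ j).card = (Finset.Ioi y).card := by
  rw [← Finset.card_map (Fin.succAboveEmb x)]
  congr 1
  ext j
  simp only [Finset.mem_filter, Finset.mem_univ, true_and, Finset.mem_map, Finset.mem_Ioi]
  constructor
  · rintro ⟨h, hx⟩
    obtain ⟨j, rfl⟩ := Fin.exists_succAbove_eq hx.symm
    exact ⟨j, by simpa using h, rfl⟩
  · rintro ⟨j, h, rfl⟩
    exact ⟨by simpa using h, by simpa using (Fin.succAbove_ne x j).symm⟩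

open Polynomial in
lemma posW_sum (q : ℂ) (k : ℕ) :
    ∑ x : Fin (k + 1), ∑ y : Fin k, posW q k x (x.succAbove y) =
      C (qint q k) * (X + C (qint q⁻¹ k)) := by
  have h1 : ∀ x : Fin (k + 1), ∑ y : Fin k, posW q k x (x.succAbove y) =
      C (qint q k) * (if x = 0 then X else C (q⁻¹ ^ (Finset.Ioi x).card)) := by
    intro x
    simp only [posW, card_above]
    rw [← Finset.sum_mul, ← map_sum, qint_rev]
  simp only [h1]
  rw [← Finset.mul_sum, Fin.sum_univ_succ, ← qint_rev q⁻¹, map_sum, if_pos rfl]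
  congr 2
  refine Finset.sum_congr rfl fun x _ => ?_
  rw [if_neg (Fin.succ_ne_zero x), Fin.card_Ioi, Fin.card_Ioi, Fin.val_succ]
  congr 2
  omega

open Polynomial in
lemma jsG_succ_aux (q : ℂ) (hq : q ≠ 0) (n k : ℕ) :
    jsG q (n + 1) k =
      ∑ x : Fin (k + 1), ∑ g : Fin n × Bool → Fin (k + 1), jsW q (n + 1) k (jsExt x x g) +
      C (qint q k) * (X + C (qint q⁻¹ k)) * jsG q n k := by
  have h : jsG q (n + 1) k = ∑ x : Fin (k + 1), ∑ y : Fin (k + 1),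
      ∑ g : Fin n × Bool → Fin (k + 1), jsW q (n + 1) k (jsExt x y g) := by
    unfold jsG
    rw [← (jsExtEquiv n (Fin (k + 1))).sum_comp]
    simp only [Fintype.sum_prod_type]
    rfl
  rw [h, ← posW_sum, Finset.sum_mul, ← Finset.sum_add_distrib]
  refine Finset.sum_congr rfl fun x _ => ?_
  rw [Fin.sum_univ_succAbove _ x, Finset.sum_mul]
  congr 1
  refine Finset.sum_congr rfl fun y _ => ?_
  rw [jsG, Finset.mul_sum]
  refine Finset.sum_congr rfl fun g _ => ?_
  exact jsW_ext q hq (Fin.succAbove_ne x y).symm g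

open Polynomial in
lemma jsG_succ_zero (q : ℂ) (hq : q ≠ 0) (n : ℕ) : jsG q (n + 1) 0 = 0 := by
  rw [jsG_succ_aux q hq, diag_zero]
  simp [qint]

open Polynomial in
lemma jsG_succ_succ (q : ℂ) (hq : q ≠ 0) (n k : ℕ) :
    jsG q (n + 1) (k + 1) = jsG q n k +
      C (qint q (k + 1)) * (X + C (qint q⁻¹ (k + 1))) * jsG q n (k + 1) := by
  rw [jsG_succ_aux q hq, diag_succ]

open Polynomial in
lemma jsG_zero_zero (q : ℂ) : jsG q 0 0 = 1 := by
  have h : ∀ f : Fin 0 × Bool → Fin 1, jsW q 0 0 f = 1 := by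
    intro f
    have : IsJSPartition 0 0 f :=
      ⟨fun a => a.elim0, fun j hj => absurd (Subsingleton.elim (α := Fin 1) _ _) hj,
        fun j hj => absurd (Subsingleton.elim (α := Fin 1) _ _) hj,
        fun j j' hj => absurd (Subsingleton.elim (α := Fin 1) _ _) hj⟩
    rw [jsW, if_pos this]
    simp [invStat, inv1, inv2, zcount]
  simp [jsG, h]

lemma jsG_zero_succ (q : ℂ) (k : ℕ) : jsG q 0 (k + 1) = 0 := by
  refine Finset.sum_eq_zero fun f _ => ?_
  rw [jsW, if_neg]
  rintro ⟨-, h, -⟩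
  obtain ⟨m, -⟩ := h (Fin.last (k + 1)) (by simp [Fin.ext_iff])
  exact m.elim0

lemma jsG_eq_zero (q : ℂ) (hq : q ≠ 0) (n : ℕ) : ∀ k, n < k → jsG q n k = 0 := by
  induction n with
  | zero =>
    rintro (_ | k) h
    · omega
    · exact jsG_zero_succ q k
  | succ n ih =>
    rintro (_ | k) h
    · omega
    · rw [jsG_succ_succ q hq, ih _ (by omega), ih _ (by omega)]
      simp

open Polynomial in
lemma jsG_expand (q : ℂ) (hq : q ≠ 0) (z : ℂ) (m : ℕ) :
    (X : ℂ[X]) ^ m = ∑ l ∈ Finset.range (m + 1), C ((jsG q m l).eval z) * jsPoly q z l := by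
  induction m with
  | zero => simp [jsG_zero_zero, jsPoly]
  | succ m ih =>
    have hstep : ∀ l, X * jsPoly q z l =
        jsPoly q z (l + 1) + C (qint q l * (z + qint q⁻¹ l)) * jsPoly q z l := by
      intro l
      have : jsPoly q z (l + 1) = jsPoly q z l * (X - C (qint q l * (z + qint q⁻¹ l))) := by
        unfold jsPoly
        rw [Finset.prod_range_succ]
      rw [this]
      ring
    rw [pow_succ', ih, Finset.mul_sum, Finset.sum_range_succ' _ (m + 1)]
    have e1 : ∀ l ∈ Finset.range (m + 1), X * (C ((jsG q m l).eval z) * jsPoly q z l) =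
        C ((jsG q m l).eval z) * jsPoly q z (l + 1) +
        C (qint q l * (z + qint q⁻¹ l) * (jsG q m l).eval z) * jsPoly q z l := by
      intro l _
      rw [mul_left_comm, hstep, C_mul (a := qint q l * (z + qint q⁻¹ l))]
      ring
    have e2 : ∀ l ∈ Finset.range (m + 1),
        C ((jsG q (m + 1) (l + 1)).eval z) * jsPoly q z (l + 1) =
        C ((jsG q m l).eval z) * jsPoly q z (l + 1) +
        C (qint q (l + 1) * (z + qint q⁻¹ (l + 1)) * (jsG q m (l + 1)).eval z) *
          jsPoly q z (l + 1) := by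
      intro l _
      rw [jsG_succ_succ q hq]
      simp only [eval_add, eval_mul, eval_C, eval_X, C_add, C_mul]
      ring
    rw [Finset.sum_congr rfl e1, Finset.sum_congr rfl e2, Finset.sum_add_distrib,
      Finset.sum_add_distrib, jsG_succ_zero q hq, add_assoc]
    congr 1
    have := Finset.sum_range_succ' (fun l =>
      C (qint q l * (z + qint q⁻¹ l) * (jsG q m l).eval z) * jsPoly q z l) (m + 1)
    rw [Finset.sum_range_succ, jsG_eq_zero q hq m (m + 1) (by omega)] at this
    simpa [qint] using this

open Polynomial in
lemma jsPoly_monic (q z : ℂ) (l : ℕ) : (jsPoly q z l).Monic :=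
  monic_prod_of_monic _ _ fun _ _ => monic_X_sub_C _

open Polynomial in
lemma jsPoly_degree (q z : ℂ) (l : ℕ) : (jsPoly q z l).natDegree = l := by
  rw [jsPoly, natDegree_prod_of_monic _ _ fun _ _ => monic_X_sub_C _]
  simp only [natDegree_X_sub_C, Finset.sum_const, Finset.card_range, smul_eq_mul, mul_one]

open Polynomial in
lemma jsPoly_unique (q z : ℂ) (a : ℕ → ℂ) (N : ℕ)
    (h : ∑ l ∈ Finset.range N, C (a l) * jsPoly q z l = 0) : ∀ l < N, a l = 0 := by
  induction N with
  | zero => intro l hl; omega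
  | succ N ih =>
    have hN : a N = 0 := by
      have hc := congrArg (fun p => coeff p N) h
      simp only [Finset.sum_range_succ, coeff_add, finsetSum_coeff, coeff_C_mul, coeff_zero] at hc
      rw [Finset.sum_eq_zero, zero_add] at hc
      · have h1 : (jsPoly q z N).coeff N = 1 := by
          have := jsPoly_monic q z N
          rwa [Monic, leadingCoeff, jsPoly_degree] at this
        simpa [h1] using hc
      · intro l hl
        rw [coeff_eq_zero_of_natDegree_lt, mul_zero]
        rw [jsPoly_degree]
        exact Finset.mem_range.1 hl
    rw [Finset.sum_range_succ, hN] at h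
    simp only [C_0, zero_mul, add_zero] at h
    intro l hl
    rcases Nat.lt_succ_iff_lt_or_eq.1 hl with h' | h'
    · exact ih h l h'
    · rw [h', hN]

open Polynomial in
lemma jsG_coeff (q : ℂ) (n k i : ℕ) : (jsG q n k).coeff i =
    ∑ f ∈ Finset.univ.filter (fun f : Fin n × Bool → Fin (k + 1) =>
          IsJSPartition n k f ∧
            (Finset.univ.filter fun a : Fin n => f (a, false) = 0).card = i),
        q ^ invStat n k f := by
  rw [jsG, finsetSum_coeff, Finset.sum_filter]
  refine Finset.sum_congr rfl fun f _ => ?_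
  unfold jsW
  by_cases hf : IsJSPartition n k f
  · simp [hf, coeff_X_pow, zcount, eq_comm]
  · simp [hf]

/-- Theorem 2.7 of the paper: the coefficient `a_{n,k}^{(i)}(q)` of
`z^i` in `JS_n^k(z;q)` is the generating polynomial `∑_{π ∈ Π(n,k,i)} q^{inv(π)}` of the
Jacobi-Stirling `k`-partitions of `[n]₂` whose zero block contains exactly `i` elements of
subscript 1, by the statistic `inv`. -/
theorem statement13 (q : ℂ) (hq : q ≠ 0) (n k : ℕ) (hn : 0 < n) (hk : 0 < k)
    (hkn : k ≤ n) (i : ℕ) (hi : i ≤ n - k)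
    (A : ℕ → ℕ → ℕ → ℂ)
    (hA : ∀ z : ℂ, ∀ m : ℕ, (Polynomial.X : Polynomial ℂ) ^ m =
      ∑ l ∈ Finset.range (m + 1),
        Polynomial.C (∑ t ∈ Finset.range (m - l + 1), A m l t * z ^ t) * jsPoly q z l) :
    A n k i =
      ∑ f ∈ Finset.univ.filter (fun f : Fin n × Bool → Fin (k + 1) =>
          IsJSPartition n k f ∧
            (Finset.univ.filter fun a : Fin n => f (a, false) = 0).card = i),
        q ^ invStat n k f := by
  rw [← jsG_coeff]
  have key : (∑ t ∈ Finset.range (n - k + 1), Polynomial.C (A n k t) * Polynomial.X ^ t : Polynomial ℂ) = jsG q n k := by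
    refine Polynomial.funext fun z => ?_
    have h := (hA z n).symm.trans (jsG_expand q hq z n)
    rw [← sub_eq_zero, ← Finset.sum_sub_distrib] at h
    simp only [← sub_mul, ← Polynomial.C_sub] at h
    have := jsPoly_unique q z _ _ h k (by omega)
    rw [sub_eq_zero] at this
    rw [← this]
    simp [Polynomial.eval_finsetSum]
  rw [← key, Polynomial.finsetSum_coeff]
  simp only [Polynomial.coeff_C_mul, Polynomial.coeff_X_pow]
  rw [Finset.sum_eq_single i]
  · simp
  · intro b _ hb
    simp [Ne.symm hb]
  · intro hi'
    exact absurd (Finset.mem_range.2 (by omega)) hi'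
end

section
/- For all complex numbers z, w, the numbers S_{z,w}(n,k) and s_{z,w}(n,k) satisfy S_{z,w}(0,0) = s_{z,w}(0,0) = 1 and, for all integers 0 ≤ k ≤ n, the triangular recurrences S_{z,w}(n+1,k+1) = S_{z,w}(n,k) + (z+k+1)(w+k+1)·S_{z,w}(n,k+1) and s_{z,w}(n+1,k+1) = s_{z,w}(n,k) − (z+n)(w+n)·s_{z,w}(n,k+1). -/
/-- `∏_{i=0}^{k-1}(x - (i+z)(i+w))`, the basis defining the symmetric generalisation
`S_{z,w}(n,k)`, `s_{z,w}(n,k)` of the Jacobi-Stirling numbers. -/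
noncomputable def zwPoly (z w : ℂ) (k : ℕ) : Polynomial ℂ :=
  ∏ i ∈ Finset.range k, (Polynomial.X - Polynomial.C (((i : ℂ) + z) * ((i : ℂ) + w)))

open Polynomial in
theorem zwPoly_succ (z w : ℂ) (k : ℕ) :
    zwPoly z w (k + 1) = zwPoly z w k * (X - C (((k : ℂ) + z) * ((k : ℂ) + w))) := by
  simp [zwPoly, Finset.prod_range_succ]

open Polynomial in
theorem zwPoly_monic (z w : ℂ) (k : ℕ) : (zwPoly z w k).Monic :=
  monic_prod_of_monic _ _ (fun _ _ => monic_X_sub_C _)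

open Polynomial in
theorem zwPoly_natDegree (z w : ℂ) (k : ℕ) : (zwPoly z w k).natDegree = k := by
  unfold zwPoly
  rw [natDegree_prod_of_monic _ _ (fun _ _ => monic_X_sub_C _)]
  simp only [natDegree_X_sub_C, Finset.sum_const, Finset.card_range, smul_eq_mul, mul_one]

open Polynomial in
theorem zwPoly_indep (z w : ℂ) (c : ℕ → ℂ) (N : ℕ)
    (h : ∑ k ∈ Finset.range N, C (c k) * zwPoly z w k = 0) : ∀ k < N, c k = 0 := by
  induction N with
  | zero => intro k hk; omega
  | succ N ih =>
    have hN : c N = 0 := by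
      have h2 := congrArg (fun p => coeff p N) h
      simp only [finsetSum_coeff, coeff_C_mul, coeff_zero, coeff_add, Finset.sum_range_succ] at h2
      rw [Finset.sum_eq_zero] at h2
      · have h3 : (zwPoly z w N).coeff N = 1 := by
          have := (zwPoly_monic z w N).coeff_natDegree
          rwa [zwPoly_natDegree] at this
        simpa [h3] using h2
      · intro k hk
        rw [coeff_eq_zero_of_natDegree_lt, mul_zero]
        rw [zwPoly_natDegree]
        exact Finset.mem_range.1 hk
    rw [Finset.sum_range_succ, hN] at h
    intro k hk
    rcases Nat.lt_succ_iff_lt_or_eq.1 hk with h1 | h1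
    · exact ih (by simpa using h) k h1
    · rw [h1, hN]

/-- initial values and triangular recurrences for the symmetric
generalised Jacobi-Stirling numbers `S_{z,w}(n,k)` and `s_{z,w}(n,k)`. -/
theorem statement15 (z w : ℂ) (S s : ℕ → ℕ → ℂ)
    (hS : ∀ m : ℕ, (Polynomial.X : Polynomial ℂ) ^ m =
      ∑ k ∈ Finset.range (m + 1), Polynomial.C (S m k) * zwPoly z w k)
    (hs : ∀ m : ℕ, zwPoly z w m =
      ∑ k ∈ Finset.range (m + 1), Polynomial.C (s m k) * Polynomial.X ^ k)
    (hS0 : ∀ m k : ℕ, m < k → S m k = 0)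
    (hs0 : ∀ m k : ℕ, m < k → s m k = 0) :
    S 0 0 = 1 ∧ s 0 0 = 1 ∧
      ∀ n k : ℕ, k ≤ n →
        S (n + 1) (k + 1) =
          S n k + (z + (k : ℂ) + 1) * (w + (k : ℂ) + 1) * S n (k + 1) ∧
        s (n + 1) (k + 1) =
          s n k - (z + (n : ℂ)) * (w + (n : ℂ)) * s n (k + 1) := by
  have hc : ∀ m k, (zwPoly z w m).coeff k = s m k := by
    intro m k
    rw [hs m]
    simp only [Polynomial.finsetSum_coeff, Polynomial.coeff_C_mul, Polynomial.coeff_X_pow]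
    by_cases hk : k < m + 1
    · simp [Finset.sum_ite_eq, hk]
    · simp [hk, hs0 m k (by omega)]
  refine ⟨?_, ?_, ?_⟩
  · have h := congrArg (fun p => Polynomial.coeff p 0) (hS 0)
    simpa [zwPoly] using h.symm
  · rw [← hc]; simp [zwPoly]
  intro n k hk
  constructor
  · have key := zwPoly_indep z w
      (fun j => S (n + 1) j - (((j : ℂ) + z) * ((j : ℂ) + w)) * S n j
        - (match j with | 0 => 0 | i + 1 => S n i)) (n + 2) ?_ (k + 1) (by omega)
    · simp only [Nat.cast_add, Nat.cast_one] at key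
      linear_combination key
    · simp only [map_sub, sub_mul, Finset.sum_sub_distrib]
      rw [← hS (n + 1)]
      rw [Finset.sum_range_succ _ (n + 1), Finset.sum_range_succ' _ (n + 1)]
      simp only [hS0 n (n + 1) (by omega), mul_zero, map_zero, zero_mul, add_zero]
      rw [pow_succ, hS n, Finset.sum_mul, ← Finset.sum_sub_distrib, ← Finset.sum_sub_distrib]
      apply Finset.sum_eq_zero
      intro j _
      rw [zwPoly_succ]
      simp only [map_mul]
      ring
  · rw [← hc, ← hc, ← hc, zwPoly_succ, mul_sub, Polynomial.coeff_sub, Polynomial.coeff_mul_X,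
      Polynomial.coeff_mul_C]
    ring
end

section
/- Let a ∈ ℂ and let n ≥ k ≥ 0 be integers such that 2a + m ≠ 0 for all integers 1 ≤ m ≤ 2k−1. Then the Wilson number of the second kind satisfies W(n,k) = Σ_{r=0}^{k} (−1)^{n−r}·(a+r)^{2n} / ( r!·(k−r)!·(2a+r)_r·(2a+2r+1)_{k−r} ), where (c)_m := c(c+1)⋯(c+m−1) is the Pochhammer symbol with (c)_0 := 1. -/
/-- The Pochhammer symbol `(c)_m := c(c+1)⋯(c+m-1)`, with `(c)_0 := 1`. -/
noncomputable def poch (c : ℂ) (m : ℕ) : ℂ := ∏ t ∈ Finset.range m, (c + (t : ℂ))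

theorem wilson_den (a : ℂ) (r d : ℕ) :
    ∏ j ∈ (Finset.range (r + d + 1)).erase r, (-(a + (r : ℂ)) ^ 2 - -(a + (j : ℂ)) ^ 2) =
      (-1) ^ r * ((r.factorial : ℂ) * (d.factorial : ℂ) *
          poch (2 * a + (r : ℂ)) r * poch (2 * a + 2 * (r : ℂ) + 1) d) := by
  have hs : (Finset.range (r + d + 1)).erase r =
      (Finset.range r) ∪ (Finset.range d).image (fun t => r + 1 + t) := by
    ext j
    simp only [Finset.mem_erase, Finset.mem_range, Finset.mem_union, Finset.mem_image]
    constructor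
    · rintro ⟨h1, h2⟩
      rcases lt_or_gt_of_ne h1 with h | h
      · exact Or.inl h
      · exact Or.inr ⟨j - (r + 1), by omega, by omega⟩
    · rintro (h | ⟨t, h1, h2⟩) <;> omega
  have hd : Disjoint (Finset.range r) ((Finset.range d).image (fun t => r + 1 + t)) := by
    rw [Finset.disjoint_left]
    intro j hj hj'
    simp only [Finset.mem_range, Finset.mem_image] at hj hj'
    obtain ⟨t, _, h⟩ := hj'
    omega
  rw [hs, Finset.prod_union hd, Finset.prod_image (by intro x _ y _ h; simpa using h)]
  have h1 : ∏ j ∈ Finset.range r, (-(a + (r : ℂ)) ^ 2 - -(a + (j : ℂ)) ^ 2) =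
      (-1) ^ r * (r.factorial : ℂ) * poch (2 * a + (r : ℂ)) r := by
    have hf : (r.factorial : ℂ) = ∏ j ∈ Finset.range r, ((r : ℂ) - (j : ℂ)) := by
      rw [← Finset.prod_range_reflect, ← Finset.prod_range_add_one_eq_factorial]
      push_cast
      refine Finset.prod_congr rfl fun j hj => ?_
      have hj' := Finset.mem_range.1 hj
      have : r - 1 - j = r - (j + 1) := by omega
      rw [this, Nat.cast_sub (by omega)]
      push_cast
      ring
    have hc : (-1 : ℂ) ^ r = ∏ j ∈ Finset.range r, (-1 : ℂ) := by simp
    rw [hf, hc, poch, ← Finset.prod_mul_distrib, ← Finset.prod_mul_distrib]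
    exact Finset.prod_congr rfl fun j _ => by ring
  have h2 : ∏ t ∈ Finset.range d, (-(a + (r : ℂ)) ^ 2 - -(a + ((r + 1 + t : ℕ) : ℂ)) ^ 2) =
      (d.factorial : ℂ) * poch (2 * a + 2 * (r : ℂ) + 1) d := by
    rw [← Finset.prod_range_add_one_eq_factorial, poch]
    push_cast
    rw [← Finset.prod_mul_distrib]
    exact Finset.prod_congr rfl fun j _ => by ring
  rw [h1, h2]
  ring

/-- explicit formula for the Wilson numbers of the second kind `W(n,k)`,
defined by `x^{2n} = ∑_{k=0}^{n} W(n,k)·∏_{j=0}^{k-1}((a+j)² + x²)`. -/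
theorem statement18 (a : ℂ) (n k : ℕ) (hkn : k ≤ n)
    (ha : ∀ m : ℕ, 1 ≤ m → m ≤ 2 * k - 1 → 2 * a + (m : ℂ) ≠ 0)
    (W : ℕ → ℕ → ℂ)
    (hW : ∀ m : ℕ, (Polynomial.X : Polynomial ℂ) ^ (2 * m) =
      ∑ l ∈ Finset.range (m + 1),
        Polynomial.C (W m l) *
          ∏ j ∈ Finset.range l, (Polynomial.C ((a + (j : ℂ)) ^ 2) + Polynomial.X ^ 2)) :
    W n k = ∑ r ∈ Finset.range (k + 1),
      (-1 : ℂ) ^ (n - r) * (a + (r : ℂ)) ^ (2 * n) /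
        ((r.factorial : ℂ) * ((k - r).factorial : ℂ) *
          poch (2 * a + (r : ℂ)) r * poch (2 * a + 2 * (r : ℂ) + 1) (k - r)) := by
  set v : ℕ → ℂ := fun r => -(a + (r : ℂ)) ^ 2 with hv
  have hinj : Set.InjOn v (Finset.range (k + 1) : Finset ℕ) := by
    have key : ∀ i j : ℕ, i < j → j ≤ k → v i ≠ v j := by
      intro i j hij hj h
      have h0 : ((j : ℂ) - (i : ℂ)) * (2 * a + ((i + j : ℕ) : ℂ)) = 0 := by
        simp only [hv] at h
        push_cast
        linear_combination h
      rcases mul_eq_zero.1 h0 with h1 | h1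
      · have : j = i := by exact_mod_cast sub_eq_zero.1 h1
        omega
      · exact ha (i + j) (by omega) (by omega) h1
    intro i hi j hj h
    simp only [Finset.coe_range, Set.mem_Iio] at hi hj
    rcases lt_trichotomy i j with hl | hl | hl
    · exact absurd h (key i j hl (by omega))
    · exact hl
    · exact absurd h.symm (key j i hl (by omega))
  set P : Polynomial ℂ := ∑ l ∈ Finset.range (k + 1),
    Polynomial.C (W n l) * Lagrange.nodal (Finset.range l) v with hP
  have hdeg : P.degree < (Finset.range (k + 1)).card := by
    rw [hP, ← Polynomial.mem_degreeLT]
    refine Submodule.sum_mem _ fun l hl => ?_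
    rw [← Polynomial.smul_eq_C_mul]
    refine Submodule.smul_mem _ _ ?_
    rw [Polynomial.mem_degreeLT, Lagrange.degree_nodal]
    have := Finset.mem_range.1 hl
    simp only [Finset.card_range]
    exact_mod_cast this
  have hco : P.coeff k = W n k := by
    rw [hP, Polynomial.finsetSum_coeff, Finset.sum_range_succ, Finset.sum_eq_zero]
    · have h1 : (Lagrange.nodal (Finset.range k) v).coeff k = 1 := by
        have := (Lagrange.nodal_monic (s := Finset.range k) (v := v)).coeff_natDegree
        rwa [Lagrange.natDegree_nodal, Finset.card_range] at this
      rw [Polynomial.coeff_C_mul, h1]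
      ring
    · intro l hl
      rw [Polynomial.coeff_C_mul, Polynomial.coeff_eq_zero_of_natDegree_lt, mul_zero]
      rw [Lagrange.natDegree_nodal, Finset.card_range]
      exact Finset.mem_range.1 hl
  have hev : ∀ r ∈ Finset.range (k + 1), P.eval (v r) = (v r) ^ n := by
    intro r hr
    have hr' := Finset.mem_range.1 hr
    have h := congrArg (Polynomial.eval (Complex.I * (a + (r : ℂ)))) (hW n)
    have hsq : (Complex.I * (a + (r : ℂ))) ^ 2 = v r := by
      rw [mul_pow, Complex.I_sq]; simp only [hv]; ring
    simp only [Polynomial.eval_pow, Polynomial.eval_X, Polynomial.eval_finsetSum,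
      Polynomial.eval_mul, Polynomial.eval_C, Polynomial.eval_prod, Polynomial.eval_add,
      pow_mul, hsq] at h
    rw [h, hP, Polynomial.eval_finsetSum]
    simp only [Polynomial.eval_mul, Polynomial.eval_C, Lagrange.eval_nodal]
    have hc : ∀ l, ∏ j ∈ Finset.range l, (v r - v j) =
        ∏ j ∈ Finset.range l, ((a + (j : ℂ)) ^ 2 + v r) := fun l =>
      Finset.prod_congr rfl fun j _ => by simp only [hv]; ring
    simp only [hc]
    refine Finset.sum_subset (Finset.range_mono (by omega)) fun l _ hl => ?_
    rw [← hc, Finset.prod_eq_zero (i := r), mul_zero]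
    · simp only [Finset.mem_range] at hl ⊢
      omega
    · ring
  have hmain := Lagrange.coeff_eq_sum hinj hdeg
  rw [Finset.card_range, Nat.add_sub_cancel, hco] at hmain
  rw [hmain]
  refine Finset.sum_congr rfl fun r hr => ?_
  have hr' := Finset.mem_range.1 hr
  rw [hev r hr]
  obtain ⟨d, rfl⟩ : ∃ d, k = r + d := ⟨k - r, by omega⟩
  obtain ⟨e, rfl⟩ : ∃ e, n = r + e := ⟨n - r, by omega⟩
  simp only [hv]
  rw [wilson_den, Nat.add_sub_cancel_left, Nat.add_sub_cancel_left, neg_pow, ← pow_mul,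
    pow_add (-1 : ℂ) r e, mul_assoc, mul_div_mul_left _ _ (pow_ne_zero _ (by norm_num))]
end

section
/- Let q ∈ ℂ and a ∈ ℂ with q ≠ 0, a ≠ 0, q^m ≠ 1 for all integers 1 ≤ m ≤ k, and a²q^m ≠ 1 for all integers 1 ≤ m ≤ 2k−1, where n ≥ k ≥ 0 are integers. Then the Askey-Wilson number of the second kind satisfies W_q(n,k) = 2^{−n}·Σ_{j=0}^{k} q^{k−j²}·a^{−2j}·(q^{j}a + q^{−j}a^{−1})^{n} / ( (q;q)_j·(q^{−2j+1}a^{−2};q)_j·(q;q)_{k−j}·(q^{2j+1}a²;q)_{k−j} ), where (c;q)_m := ∏_{t=0}^{m−1}(1 − cq^t) with (c;q)_0 := 1. -/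
/-- The `q`-shifted factorial `(c;q)_m := ∏_{t=0}^{m-1}(1 - c q^t)`, with `(c;q)_0 := 1`. -/
noncomputable def qPoch (q c : ℂ) (m : ℕ) : ℂ := ∏ t ∈ Finset.range m, (1 - c * q ^ t)

open Polynomial in
lemma aw_phi_aux (b c : ℕ → ℂ) (l : ℕ) :
    (∏ j ∈ Finset.range l, (C (b j) - C (c j) * X)).natDegree ≤ l ∧
    (∏ j ∈ Finset.range l, (C (b j) - C (c j) * X)).coeff l = ∏ j ∈ Finset.range l, (-c j) := by
  have h1 : ∀ j, (C (b j) - C (c j) * X).natDegree ≤ 1 := by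
    intro j
    refine (natDegree_sub_le _ _).trans ?_
    simp only [natDegree_C]
    exact max_le (by omega) ((natDegree_C_mul_le _ _).trans natDegree_X_le)
  induction l with
  | zero => simp
  | succ l ih =>
    rw [Finset.prod_range_succ, Finset.prod_range_succ]
    refine ⟨natDegree_mul_le_of_le ih.1 (h1 l), ?_⟩
    rw [coeff_mul_add_eq_of_natDegree_le ih.1 (h1 l), ih.2]
    simp [coeff_C]

lemma aw_prod_split (f : ℕ → ℂ) (k j : ℕ) (hj : j ≤ k) :
    ∏ i ∈ (Finset.range (k + 1)).erase j, f i =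
      (∏ t ∈ Finset.range j, f (j - 1 - t)) * ∏ t ∈ Finset.range (k - j), f (j + 1 + t) := by
  rw [Finset.prod_range_reflect]
  have h : (Finset.range (k + 1)).erase j = Finset.range j ∪ Finset.Ico (j + 1) (k + 1) := by
    ext i; simp; omega
  rw [h, Finset.prod_union, Finset.prod_Ico_eq_prod_range]
  · congr 2; congr 1; omega
  · rw [Finset.disjoint_left]; intro i; simp; omega

/-- nodes -/
noncomputable def awNode (q a : ℂ) (j : ℕ) : ℂ := (q ^ j * a + q ^ (-(j : ℤ)) * a⁻¹) / 2

lemma aw_node_sub (q a : ℂ) (hq : q ≠ 0) (ha : a ≠ 0) (i j : ℕ) :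
    (-(2 * a * q ^ i)) * (awNode q a j - awNode q a i) =
      (1 - a ^ 2 * q ^ (i + j)) * (1 - q ^ ((i : ℤ) - j)) := by
  unfold awNode
  rw [zpow_sub₀ hq, zpow_neg, zpow_neg]
  simp only [zpow_natCast]
  field_simp
  ring

lemma aw_phi_eval (q a : ℂ) (hq : q ≠ 0) (ha : a ≠ 0) (i : ℕ) (x : ℂ) :
    1 + a ^ 2 * q ^ (2 * i) - 2 * a * q ^ i * x = (-(2 * a * q ^ i)) * (x - awNode q a i) := by
  unfold awNode
  rw [zpow_neg]
  simp only [zpow_natCast]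
  field_simp
  ring

lemma aw_low (q a : ℂ) (hq : q ≠ 0) (ha : a ≠ 0) (j : ℕ) :
    ∏ t ∈ Finset.range j, ((1 - a ^ 2 * q ^ ((j - 1 - t) + j)) *
      (1 - q ^ (((j - 1 - t : ℕ) : ℤ) - j))) =
    a ^ (2 * j) * q ^ ((j : ℤ) ^ 2 - j) *
      (qPoch q q j * qPoch q (q ^ (1 - 2 * (j : ℤ)) * a ^ (-2 : ℤ)) j) := by
  have key : ∀ t ∈ Finset.range j, ((1 - a ^ 2 * q ^ ((j - 1 - t) + j)) *
      (1 - q ^ (((j - 1 - t : ℕ) : ℤ) - j))) =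
      a ^ 2 * q ^ (2 * (((j - 1 - t : ℕ) : ℤ))) *
       ((1 - q * q ^ t) * (1 - q ^ (1 - 2 * (j : ℤ)) * a ^ (-2 : ℤ) * q ^ t)) := by
    intro t ht
    have ht' := Finset.mem_range.1 ht
    obtain ⟨s, rfl⟩ : ∃ s, j = s + 1 + t := ⟨j - 1 - t, by omega⟩
    have e : s + 1 + t - 1 - t = s := by omega
    rw [e]
    have e1 : q ^ ((s : ℤ) - ((s + 1 + t : ℕ) : ℤ)) = (q * q ^ t)⁻¹ := by
      rw [← pow_succ', ← zpow_natCast, ← zpow_neg]; congr 1; push_cast; ring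
    have e2 : q ^ (1 - 2 * ((s + 1 + t : ℕ) : ℤ)) = (q ^ (2 * s + 1 + 2 * t))⁻¹ := by
      rw [← zpow_natCast, ← zpow_neg]; congr 1; push_cast; ring
    have e3 : q ^ (2 * (s : ℤ)) = q ^ (2 * s) := by
      rw [← zpow_natCast]; congr 1
    have e4 : a ^ (-2 : ℤ) = (a ^ 2)⁻¹ := by
      rw [← zpow_natCast, ← zpow_neg]; congr 1
    rw [e1, e2, e3, e4]
    have hqt : q ^ t ≠ 0 := pow_ne_zero _ hq
    have hqs : q ^ s ≠ 0 := pow_ne_zero _ hq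
    have e5 : q ^ (2 * s + 1 + 2 * t) = (q ^ s) ^ 2 * q * (q ^ t) ^ 2 := by ring
    have e6 : q ^ (s + (s + 1 + t)) = (q ^ s) ^ 2 * q * (q ^ t) := by ring
    have e7 : q ^ (2 * s) = (q ^ s) ^ 2 := by ring
    rw [e5, e6, e7]
    generalize q ^ t = T at *
    generalize q ^ s = S at *
    field_simp
    ring
  rw [Finset.prod_congr rfl key, Finset.prod_mul_distrib, Finset.prod_mul_distrib,
    Finset.prod_mul_distrib]
  rw [Finset.prod_range_reflect (fun t : ℕ => q ^ (2 * (t : ℤ)))]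
  have h2 : ∀ m : ℕ, ∏ t ∈ Finset.range m, q ^ (2 * (t : ℤ)) = q ^ ((m : ℤ) ^ 2 - m) := by
    intro m
    induction m with
    | zero => simp
    | succ m ih =>
      rw [Finset.prod_range_succ, ih, ← zpow_add₀ hq]; congr 1; push_cast; ring
  rw [h2]
  simp only [Finset.prod_const, Finset.card_range, qPoch, ← pow_mul]

lemma aw_high (q a : ℂ) (hq : q ≠ 0) (j m : ℕ) :
    ∏ t ∈ Finset.range m, ((1 - a ^ 2 * q ^ ((j + 1 + t) + j)) *
      (1 - q ^ (((j + 1 + t : ℕ) : ℤ) - j))) =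
    qPoch q q m * qPoch q (q ^ (2 * (j : ℤ) + 1) * a ^ 2) m := by
  unfold qPoch
  rw [← Finset.prod_mul_distrib]
  refine Finset.prod_congr rfl fun t _ => ?_
  have e1 : q ^ (((j + 1 + t : ℕ) : ℤ) - j) = q * q ^ t := by
    rw [← pow_succ', ← zpow_natCast]; congr 1; push_cast; ring
  have e2 : q ^ (2 * (j : ℤ) + 1) = q ^ (2 * j + 1) := by
    rw [← zpow_natCast]; congr 1
  rw [e1, e2]; ring

lemma aw_den (q a : ℂ) (hq : q ≠ 0) (ha : a ≠ 0) (k j : ℕ) (hj : j ≤ k) :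
    (∏ i ∈ Finset.range k, (-(2 * a * q ^ i))) * q ^ ((k : ℤ) - j) *
      ∏ i ∈ (Finset.range (k + 1)).erase j, (awNode q a j - awNode q a i) =
    a ^ (2 * j) * q ^ ((j : ℤ) ^ 2 - j) *
      (qPoch q q j * qPoch q (q ^ (1 - 2 * (j : ℤ)) * a ^ (-2 : ℤ)) j *
            qPoch q q (k - j) * qPoch q (q ^ (2 * (j : ℤ) + 1) * a ^ 2) (k - j)) := by
  have h1 : (∏ i ∈ Finset.range k, (-(2 * a * q ^ i))) * q ^ ((k : ℤ) - j) =
      ∏ i ∈ (Finset.range (k + 1)).erase j, (-(2 * a * q ^ i)) := by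
    have hc : (-(2 * a * q ^ j)) ≠ 0 := by simp [hq, ha]
    apply mul_right_cancel₀ hc
    rw [Finset.prod_erase_mul _ _ (Finset.mem_range.2 (by omega)), Finset.prod_range_succ,
      zpow_sub₀ hq]
    simp only [zpow_natCast]
    field_simp
  rw [h1, ← Finset.prod_mul_distrib,
    Finset.prod_congr rfl (fun i _ => aw_node_sub q a hq ha i j),
    aw_prod_split _ k j hj, aw_low q a hq ha, aw_high q a hq]
  ring

lemma aw_inj (q a : ℂ) (hq : q ≠ 0) (ha : a ≠ 0) (k : ℕ)
    (hq1 : ∀ m : ℕ, 1 ≤ m → m ≤ k → q ^ m ≠ 1)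
    (ha1 : ∀ m : ℕ, 1 ≤ m → m ≤ 2 * k - 1 → a ^ 2 * q ^ m ≠ 1) :
    Set.InjOn (awNode q a) (Finset.range (k + 1) : Finset ℕ) := by
  have main : ∀ i j : ℕ, j < i → i ≤ k → awNode q a j ≠ awNode q a i := by
    intro i j hji hik h
    have := aw_node_sub q a hq ha i j
    rw [h, sub_self, mul_zero, eq_comm, mul_eq_zero, sub_eq_zero, sub_eq_zero] at this
    rcases this with h | h
    · exact ha1 (i + j) (by omega) (by omega) h.symm
    · refine hq1 (i - j) (by omega) (by omega) ?_
      rw [h, ← zpow_natCast]; congr 1; omega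
  intro i hi j hj h
  simp at hi hj
  rcases lt_trichotomy i j with h' | h' | h'
  · exact absurd h (main j i h' (by omega))
  · exact h'
  · exact absurd h.symm (main i j h' (by omega))


/-- explicit formula for the Askey-Wilson numbers of the second kind
`W_q(n,k)`, defined by `x^n = ∑_{k=0}^{n} W_q(n,k)·∏_{j=0}^{k-1}(1 - 2axq^j + a²q^{2j})`. -/
theorem statement19 (q a : ℂ) (hq : q ≠ 0) (ha : a ≠ 0) (n k : ℕ) (hkn : k ≤ n)
    (hq1 : ∀ m : ℕ, 1 ≤ m → m ≤ k → q ^ m ≠ 1)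
    (ha1 : ∀ m : ℕ, 1 ≤ m → m ≤ 2 * k - 1 → a ^ 2 * q ^ m ≠ 1)
    (W : ℕ → ℕ → ℂ)
    (hW : ∀ m : ℕ, (Polynomial.X : Polynomial ℂ) ^ m =
      ∑ l ∈ Finset.range (m + 1),
        Polynomial.C (W m l) *
          ∏ j ∈ Finset.range l,
            (Polynomial.C (1 + a ^ 2 * q ^ (2 * j)) - Polynomial.C (2 * a * q ^ j) * Polynomial.X)) :
    W n k = (2 : ℂ) ^ (-(n : ℤ)) *
      ∑ j ∈ Finset.range (k + 1),
        q ^ ((k : ℤ) - (j : ℤ) ^ 2) * a ^ (-(2 * j : ℤ)) *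
          (q ^ j * a + q ^ (-(j : ℤ)) * a⁻¹) ^ n /
          (qPoch q q j * qPoch q (q ^ (1 - 2 * (j : ℤ)) * a ^ (-2 : ℤ)) j *
            qPoch q q (k - j) * qPoch q (q ^ (2 * (j : ℤ) + 1) * a ^ 2) (k - j)) := by
  classical
  set Φ : ℕ → Polynomial ℂ := fun l => ∏ j ∈ Finset.range l,
    (Polynomial.C (1 + a ^ 2 * q ^ (2 * j)) - Polynomial.C (2 * a * q ^ j) * Polynomial.X) with hΦ
  have hΦd := fun l => aw_phi_aux (fun j => 1 + a ^ 2 * q ^ (2 * j)) (fun j => 2 * a * q ^ j) l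
  have hev : ∀ l x, (Φ l).eval x =
      ∏ i ∈ Finset.range l, (-(2 * a * q ^ i)) * (x - awNode q a i) := by
    intro l x
    simp only [hΦ, Polynomial.eval_prod]
    refine Finset.prod_congr rfl fun i _ => ?_
    rw [← aw_phi_eval q a hq ha]
    simp
  set P : Polynomial ℂ := ∑ l ∈ Finset.range (k + 1), Polynomial.C (W n l) * Φ l with hP
  have hPd : P.natDegree ≤ k := by
    refine Polynomial.natDegree_sum_le_of_forall_le _ _ fun l hl => ?_
    have := Finset.mem_range.1 hl
    exact (Polynomial.natDegree_C_mul_le _ _).trans ((hΦd l).1.trans (by omega))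
  have hPc : P.coeff k = W n k * ∏ i ∈ Finset.range k, (-(2 * a * q ^ i)) := by
    rw [hP, Polynomial.finsetSum_coeff, Finset.sum_range_succ, Finset.sum_eq_zero, zero_add,
      Polynomial.coeff_C_mul]
    · exact congrArg _ (hΦd k).2
    · intro l hl
      have := Finset.mem_range.1 hl
      rw [Polynomial.coeff_C_mul, Polynomial.coeff_eq_zero_of_natDegree_lt, mul_zero]
      exact lt_of_le_of_lt (hΦd l).1 this
  have hPe : ∀ j ∈ Finset.range (k + 1), P.eval (awNode q a j) = awNode q a j ^ n := by
    intro j hj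
    have := congrArg (Polynomial.eval (awNode q a j)) (hW n)
    rw [Polynomial.eval_pow, Polynomial.eval_X] at this
    rw [this, hP, Polynomial.eval_finsetSum, Polynomial.eval_finsetSum]
    refine Finset.sum_subset (by intro i; simp; omega) fun l _ hl => ?_
    rw [Polynomial.eval_mul, hev, Finset.prod_eq_zero (i := j), mul_zero]
    · simp at hl hj ⊢; omega
    · simp
  have hinj := aw_inj q a hq ha k hq1 ha1
  have hsum := Lagrange.coeff_eq_sum hinj (P := P) (by
    rw [Finset.card_range]
    exact lt_of_le_of_lt Polynomial.degree_le_natDegree (by exact_mod_cast Nat.lt_succ_of_le hPd))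
  rw [Finset.card_range, Nat.add_sub_cancel, hPc] at hsum
  have hc : ∏ i ∈ Finset.range k, (-(2 * a * q ^ i)) ≠ 0 :=
    Finset.prod_ne_zero_iff.2 fun i _ => by simp [hq, ha]
  rw [← eq_div_iff hc] at hsum
  rw [hsum, Finset.sum_div, Finset.mul_sum]
  refine Finset.sum_congr rfl fun j hj => ?_
  rw [hPe j hj]
  have hden := aw_den q a hq ha k j (by have := Finset.mem_range.1 hj; omega)
  set D := (qPoch q q j * qPoch q (q ^ (1 - 2 * (j : ℤ)) * a ^ (-2 : ℤ)) j *
            qPoch q q (k - j) * qPoch q (q ^ (2 * (j : ℤ) + 1) * a ^ 2) (k - j))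
  have hE : ∏ i ∈ (Finset.range (k + 1)).erase j, (awNode q a j - awNode q a i) ≠ 0 := by
    refine Finset.prod_ne_zero_iff.2 fun i hi => ?_
    rw [Finset.mem_erase] at hi
    exact sub_ne_zero.2 fun h => hi.1 (hinj (Finset.mem_coe.2 hj) (Finset.mem_coe.2 hi.2) h).symm
  have hqk : q ^ ((k : ℤ) - j) ≠ 0 := zpow_ne_zero _ hq
  have hqj : q ^ ((j : ℤ) ^ 2 - j) ≠ 0 := zpow_ne_zero _ hq
  have hD : D ≠ 0 := by
    intro h
    rw [h, mul_zero] at hden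
    exact mul_ne_zero (mul_ne_zero hc hqk) hE hden
  have e1 : q ^ ((k : ℤ) - (j : ℤ) ^ 2) = q ^ ((k : ℤ) - j) / q ^ ((j : ℤ) ^ 2 - j) := by
    rw [← zpow_sub₀ hq]; congr 1; ring
  have e2 : a ^ (-(2 * j : ℤ)) = (a ^ (2 * j))⁻¹ := by
    rw [← zpow_natCast, ← zpow_neg]; congr 1
  have e3 : (2 : ℂ) ^ (-(n : ℤ)) = (2 ^ n)⁻¹ := by
    rw [zpow_neg, zpow_natCast]
  have e4 : awNode q a j ^ n = (q ^ j * a + q ^ (-(j : ℤ)) * a⁻¹) ^ n / 2 ^ n := by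
    rw [awNode, div_pow]
  rw [e1, e2, e3, e4]
  generalize (q ^ j * a + q ^ (-(j : ℤ)) * a⁻¹) ^ n = Z
  have haj : a ^ (2 * j) ≠ 0 := pow_ne_zero _ ha
  have h2 : (2 : ℂ) ^ n ≠ 0 := by simp
  generalize q ^ ((k : ℤ) - j) = A at *
  generalize q ^ ((j : ℤ) ^ 2 - j) = B at *
  generalize a ^ (2 * j) = G at *
  generalize (2 : ℂ) ^ n = T at *
  generalize ∏ i ∈ (Finset.range (k + 1)).erase j, (awNode q a j - awNode q a i) = E at *
  generalize ∏ i ∈ Finset.range k, (-(2 * a * q ^ i)) = F at *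
  clear_value D
  have : Z / T / E / F = T⁻¹ * Z * A / (F * A * E) := by field_simp
  rw [this, hden]
  field_simp
end
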